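/- arXiv:1310.4755 — 2 statements merged into one kernel-verified Lean document; each statement's English description precedes it below -/
import Mathlib

section
/- The space of symmetric vector valued forms on a ℤ-graded vector space E, graded by the degree of forms as graded maps and equipped with the Richardson–Nijenhuis bracket, is a graded Lie algebra: for all symmetric vector valued forms K, L, M of degrees K̄, L̄, M̄ one has the graded antisymmetry [K,L]_RN = −(−1)^{K̄L̄}[L,K]_RN and the graded Jacobi identity [K,[L,M]_RN]_RN = [[K,L]_RN,M]_RN + (−1)^{K̄L̄}[L,[K,M]_RN]_RN. -/
open scoped DirectSum
open Classical

noncomputable section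

namespace RN

section Core

variable (𝕜 : Type) [Field 𝕜] [CharZero 𝕜]
variable (E : ℤ → Type) [∀ i, AddCommGroup (E i)] [∀ i, Module 𝕜 (E i)]

/-- Raw vector-valued forms on the graded vector space `E`: for every arity `n` and every
vector of (input) degrees `ι`, a function on homogeneous tuples with values in the total
graded space `⨁ i, E i`. -/
abbrev RawForm : Type :=
  ∀ n : ℕ, ∀ ι : Fin n → ℤ, (∀ j, E (ι j)) → ⨁ i, E i

/-- Multilinearity (in each slot, on homogeneous arguments). -/
def IsMultilin (F : RawForm E) : Prop :=
  ∀ (n : ℕ) (ι : Fin n → ℤ) (x : ∀ j, E (ι j)) (j : Fin n) (a b : E (ι j)) (c : 𝕜),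
    F n ι (Function.update x j (a + b)) =
        F n ι (Function.update x j a) + F n ι (Function.update x j b) ∧
      F n ι (Function.update x j (c • a)) = c • F n ι (Function.update x j a)

/-- Graded symmetry: swapping two adjacent homogeneous arguments multiplies the value
by the Koszul sign `(-1)^{|X||Y|}`. -/
def IsGradedSym (F : RawForm E) : Prop :=
  ∀ (n : ℕ) (ι : Fin n → ℤ) (x : ∀ j, E (ι j)) (p q : Fin n), (p : ℕ) + 1 = (q : ℕ) →
    F n (fun j => ι (Equiv.swap p q j)) (fun j => x (Equiv.swap p q j)) =
      ((-1 : 𝕜) ^ (ι p * ι q)) • F n ι x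

/-- `F` has degree `d`: its value on homogeneous arguments of degrees `ι` is homogeneous
of degree `(∑ j, ι j) + d`. -/
def IsOfDeg (d : ℤ) (F : RawForm E) : Prop :=
  ∀ (n : ℕ) (ι : Fin n → ℤ) (x : ∀ j, E (ι j)) (m : ℤ),
    m ≠ (∑ j, ι j) + d → F n ι x m = 0

/-- Symmetric vector valued form of degree `d`. -/
def IsSVF (d : ℤ) (F : RawForm E) : Prop :=
  IsMultilin 𝕜 E F ∧ IsGradedSym 𝕜 E F ∧ IsOfDeg E d F

/-- `F` is (concentrated in) a `k`-form. -/
def IsArity (k : ℕ) (F : RawForm E) : Prop :=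
  ∀ n, n ≠ k → ∀ (ι : Fin n → ℤ) (x : ∀ j, E (ι j)), F n ι x = 0

/-- `F` has no 0-form (curvature) component. -/
def NoCurv (F : RawForm E) : Prop :=
  ∀ (ι : Fin 0 → ℤ) (x : ∀ j, E (ι j)), F 0 ι x = 0

/-- `(k, n-k)`-shuffles of `Fin n`. -/
def IsShuffle (k : ℕ) {n : ℕ} (σ : Equiv.Perm (Fin n)) : Prop :=
  ∀ i j : Fin n, i < j → ((j : ℕ) < k ∨ k ≤ (i : ℕ)) → σ i < σ j

/-- The Koszul sign of the rearrangement `(X_{σ(1)},…,X_{σ(n)})` of homogeneous elements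
of degrees `ι`. -/
def koszulSign {n : ℕ} (ι : Fin n → ℤ) (σ : Equiv.Perm (Fin n)) : 𝕜 :=
  ∏ p ∈ Finset.univ.filter (fun p : Fin n × Fin n => p.1 < p.2 ∧ σ p.2 < σ p.1),
    (-1 : 𝕜) ^ (ι (σ p.1) * ι (σ p.2))

/-- Prepend a degree to a vector of degrees. -/
def dcons {n : ℕ} (m : ℤ) (rest : Fin n → ℤ) : Fin (n + 1) → ℤ :=
  fun j => if h : (j : ℕ) = 0 then m else rest ⟨(j : ℕ) - 1, by have := j.isLt; omega⟩

/-- Prepend a homogeneous element to a tuple of homogeneous elements. -/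
def dconsV {n : ℕ} {m : ℤ} {rest : Fin n → ℤ} (v : E m) (xs : ∀ i, E (rest i)) :
    ∀ j : Fin (n + 1), E (dcons m rest j) := fun j => by
  unfold dcons
  by_cases h : (j : ℕ) = 0
  · rw [dif_pos h]; exact v
  · rw [dif_neg h]; exact xs ⟨(j : ℕ) - 1, by have := j.isLt; omega⟩

/-- The insertion operator `ι_F G`, summing over shuffles with Koszul signs. -/
def ins (F G : RawForm E) : RawForm E :=
  fun n ι x =>
    ∑ k : Fin (n + 1),
      ∑ σ ∈ Finset.univ.filter (fun σ : Equiv.Perm (Fin n) => IsShuffle (k : ℕ) σ),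
        koszulSign 𝕜 ι σ •
          DFinsupp.sum
            (F (k : ℕ)
              (fun i => ι (σ ⟨(i : ℕ), by have h1 := i.isLt; have h2 := k.isLt; omega⟩))
              (fun i => x (σ ⟨(i : ℕ), by have h1 := i.isLt; have h2 := k.isLt; omega⟩)))
            (fun m v =>
              G (n - (k : ℕ) + 1)
                (dcons m
                  (fun i => ι (σ ⟨(k : ℕ) + (i : ℕ), by have h1 := i.isLt; have h2 := k.isLt; omega⟩)))
                (dconsV E v
                  (fun i => x (σ ⟨(k : ℕ) + (i : ℕ), by have h1 := i.isLt; have h2 := k.isLt; omega⟩))))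

/-- The Richardson–Nijenhuis bracket `[F,G]_RN = ι_F G - (-1)^{dK·dL} ι_G F` of forms
of degrees `dK` and `dL`. -/
def rnb (dK dL : ℤ) (F G : RawForm E) : RawForm E :=
  fun n ι x => ins 𝕜 E F G n ι x - ((-1 : 𝕜) ^ (dK * dL)) • ins 𝕜 E G F n ι x

/-- An element of the graded vector space, regarded as a vector valued 0-form. -/
def ofElem (v : ⨁ i, E i) : RawForm E := fun n _ _ => if n = 0 then v else 0

/-- The Euler map `S(X) = -|X|·X`, a vector valued 1-form of degree 0. -/
def euler : RawForm E :=
  fun n ι x =>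
    if h : n = 1 then
      (-(ι ⟨0, by omega⟩)) • DirectSum.of E (ι ⟨0, by omega⟩) (x ⟨0, by omega⟩)
    else 0

/-- The identity map of `E`, regarded as a vector valued 1-form of degree 0. -/
def idF : RawForm E :=
  fun n ι x =>
    if h : n = 1 then DirectSum.of E (ι ⟨0, by omega⟩) (x ⟨0, by omega⟩) else 0

/-- The arity-`k` component of a vector valued form. -/
def comp (F : RawForm E) (k : ℕ) : RawForm E :=
  fun n ι x => if n = k then F n ι x else 0

end Core

section Lists

variable {𝕜 : Type} [Field 𝕜]
variable {E : ℤ → Type}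
variable {V W : Type} [AddCommGroup V] [Module 𝕜 V] [AddCommGroup W] [Module 𝕜 W]

theorem neg_one_zpow_congr {a b : ℤ} (h : Even (a - b)) : (-1 : 𝕜) ^ a = (-1 : 𝕜) ^ b := by
  have h1 : a = (a - b) + b := by ring
  rw [h1, zpow_add₀ (by simp), h.neg_one_zpow, one_mul]

theorem neg_one_zpow_mul (a b : ℤ) : (-1 : 𝕜) ^ a * (-1 : 𝕜) ^ b = (-1 : 𝕜) ^ (a + b) :=
  (zpow_add₀ (by simp) a b).symm

/-- The total degree of a list of homogeneous elements. -/
def listDeg (l : List (Σ i, E i)) : ℤ := (l.map Sigma.fst).sum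

@[simp] theorem listDeg_nil : listDeg ([] : List (Σ i, E i)) = 0 := rfl

@[simp] theorem listDeg_cons (x : Σ i, E i) (l : List (Σ i, E i)) :
    listDeg (x :: l) = x.1 + listDeg l := by
  simp [listDeg]

variable (𝕜) in
/-- The sum of `Φ a b`, weighted by Koszul signs, over all splittings of `l` into two complementary
sublists `a` and `b`. -/
def unshuffle : List (Σ i, E i) → (List (Σ i, E i) → List (Σ i, E i) → V) → V
  | [], Φ => Φ [] []
  | x :: l, Φ => unshuffle l (fun a b => Φ (x :: a) b) +
      unshuffle l (fun a b => (-1 : 𝕜) ^ (x.1 * listDeg a) • Φ a (x :: b))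

theorem unshuffle_congr (l : List (Σ i, E i)) {Φ Ψ : List (Σ i, E i) → List (Σ i, E i) → V}
    (h : ∀ a b, listDeg a + listDeg b = listDeg l → Φ a b = Ψ a b) :
    unshuffle 𝕜 l Φ = unshuffle 𝕜 l Ψ := by
  induction l generalizing Φ Ψ with
  | nil => exact h [] [] (by simp)
  | cons x l ih =>
    refine congrArg₂ (· + ·) (ih fun a b hab => ?_) (ih fun a b hab => ?_)
    · exact h _ _ (by simp only [listDeg_cons]; linarith)
    · rw [h _ _ (by simp only [listDeg_cons]; linarith)]

theorem map_unshuffle (φ : V →ₗ[𝕜] W) (l : List (Σ i, E i))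
    (Φ : List (Σ i, E i) → List (Σ i, E i) → V) :
    φ (unshuffle 𝕜 l Φ) = unshuffle 𝕜 l (fun a b => φ (Φ a b)) := by
  induction l generalizing Φ with
  | nil => rfl
  | cons x l ih => simp only [unshuffle, map_add, ih, map_smul]

theorem unshuffle_add (l : List (Σ i, E i)) (Φ Ψ : List (Σ i, E i) → List (Σ i, E i) → V) :
    unshuffle 𝕜 l (fun a b => Φ a b + Ψ a b) = unshuffle 𝕜 l Φ + unshuffle 𝕜 l Ψ := by
  induction l generalizing Φ Ψ with
  | nil => rfl
  | cons x l ih =>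
    simp only [unshuffle, smul_add, ih]
    abel

theorem unshuffle_smul (c : 𝕜) (l : List (Σ i, E i))
    (Φ : List (Σ i, E i) → List (Σ i, E i) → V) :
    unshuffle 𝕜 l (fun a b => c • Φ a b) = c • unshuffle 𝕜 l Φ :=
  (map_unshuffle (LinearMap.lsmul 𝕜 V c) l Φ).symm

/-- Coassociativity of unshuffling. -/
theorem unshuffle_coassoc (l : List (Σ i, E i))
    (Φ : List (Σ i, E i) → List (Σ i, E i) → List (Σ i, E i) → V) :
    unshuffle 𝕜 l (fun e d => unshuffle 𝕜 e (fun a c => Φ a c d)) =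
      unshuffle 𝕜 l (fun a b => unshuffle 𝕜 b (fun c d => Φ a c d)) := by
  induction l generalizing Φ with
  | nil => rfl
  | cons x l ih =>
    simp only [unshuffle, unshuffle_add, smul_add, ← unshuffle_smul]
    rw [ih, ih (fun a c d => (-1 : 𝕜) ^ (x.1 * listDeg a) • Φ a (x :: c) d), add_assoc,
      ← ih (fun a c d => (-1 : 𝕜) ^ (x.1 * listDeg a) • (-1 : 𝕜) ^ (x.1 * listDeg c) •
        Φ a c (x :: d))]
    congr 2
    refine unshuffle_congr l fun e d _ => unshuffle_congr e fun a c hac => ?_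
    rw [smul_smul, neg_one_zpow_mul, ← mul_add, hac]

/-- Graded cocommutativity of unshuffling. -/
theorem unshuffle_swap (l : List (Σ i, E i)) (Φ : List (Σ i, E i) → List (Σ i, E i) → V) :
    unshuffle 𝕜 l (fun a b => (-1 : 𝕜) ^ (listDeg a * listDeg b) • Φ b a) =
      unshuffle 𝕜 l Φ := by
  induction l generalizing Φ with
  | nil => simp [unshuffle]
  | cons x l ih =>
    simp only [unshuffle]
    rw [add_comm, ← ih (fun a b => Φ (x :: a) b),
      ← ih (fun a b => (-1 : 𝕜) ^ (x.1 * listDeg a) • Φ a (x :: b))]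
    congr 1 <;> refine unshuffle_congr l fun a b _ => ?_
    · rw [smul_smul, neg_one_zpow_mul]
      congr 1
      exact neg_one_zpow_congr ⟨x.1 * listDeg a, by simp only [listDeg_cons]; ring⟩
    · rw [smul_smul, neg_one_zpow_mul]
      congr 1
      exact neg_one_zpow_congr ⟨0, by simp only [listDeg_cons]; ring⟩

theorem unshuffle_unshuffle_swap (l : List (Σ i, E i))
    (Φ : List (Σ i, E i) → List (Σ i, E i) → List (Σ i, E i) → V) :
    unshuffle 𝕜 l (fun a b => unshuffle 𝕜 b
      (fun c d => (-1 : 𝕜) ^ (listDeg a * listDeg c) • Φ c a d)) =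
      unshuffle 𝕜 l (fun a b => unshuffle 𝕜 b (fun c d => Φ a c d)) := by
  rw [← unshuffle_coassoc, ← unshuffle_coassoc]
  exact unshuffle_congr l fun e d _ => unshuffle_swap e fun a c => Φ a c d

variable [∀ i, AddCommGroup (E i)] [∀ i, Module 𝕜 (E i)]

/-- A form of degree `d`, as a function of lists of homogeneous elements. -/
def ListHomogeneous (d : ℤ) (F : List (Σ i, E i) → ⨁ i, E i) : Prop :=
  ∀ l m, m ≠ listDeg l + d → F l m = 0

variable (𝕜) in
/-- Linearity in the first argument. -/
def HeadLinear (F : List (Σ i, E i) → ⨁ i, E i) : Prop :=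
  ∀ (m : ℤ) (b : List (Σ i, E i)), ∃ φ : E m →ₗ[𝕜] ⨁ i, E i, ∀ v, φ v = F (⟨m, v⟩ :: b)

variable (𝕜) in
/-- Graded symmetry in the first two arguments. -/
def HeadSymm (F : List (Σ i, E i) → ⨁ i, E i) : Prop :=
  ∀ (u w : Σ i, E i) (b : List (Σ i, E i)),
    F (u :: w :: b) = (-1 : 𝕜) ^ (w.1 * u.1) • F (w :: u :: b)

/-- The value on `a` of a form of degree `d`, as a homogeneous element. -/
def homValue (d : ℤ) (F : List (Σ i, E i) → ⨁ i, E i) (a : List (Σ i, E i)) : Σ i, E i :=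
  ⟨listDeg a + d, F a (listDeg a + d)⟩

variable (𝕜) in
/-- The insertion of a form `F` of degree `d` into `G`, in terms of lists. -/
def listIns (d : ℤ) (F G : List (Σ i, E i) → ⨁ i, E i) (l : List (Σ i, E i)) : ⨁ i, E i :=
  unshuffle 𝕜 l (fun a b => G (homValue d F a :: b))

theorem HeadLinear.map_zero {G : List (Σ i, E i) → ⨁ i, E i} (hG : HeadLinear 𝕜 G)
    (m : ℤ) (b : List (Σ i, E i)) : G (⟨m, 0⟩ :: b) = 0 := by
  obtain ⟨φ, hφ⟩ := hG m b
  rw [← hφ, LinearMap.map_zero]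

theorem HeadLinear.exists_linearMap {G : List (Σ i, E i) → ⨁ i, E i} (hG : HeadLinear 𝕜 G)
    (m : ℤ) (b : List (Σ i, E i)) :
    ∃ φ : (⨁ i, E i) →ₗ[𝕜] ⨁ i, E i, ∀ v, φ v = G (⟨m, v m⟩ :: b) := by
  obtain ⟨φ, hφ⟩ := hG m b
  exact ⟨φ ∘ₗ DirectSum.component 𝕜 ℤ E m, fun v => hφ _⟩

theorem listIns_sub_smul_left (d : ℤ) (F F' : List (Σ i, E i) → ⨁ i, E i) (s : 𝕜)
    {G : List (Σ i, E i) → ⨁ i, E i} (hG : HeadLinear 𝕜 G) (l : List (Σ i, E i)) :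
    listIns 𝕜 d (fun l => F l - s • F' l) G l =
      listIns 𝕜 d F G l - s • listIns 𝕜 d F' G l := by
  unfold listIns
  rw [sub_eq_add_neg, ← neg_smul, ← unshuffle_smul, ← unshuffle_add]
  refine unshuffle_congr l fun a b _ => ?_
  obtain ⟨φ, hφ⟩ := hG.exists_linearMap (listDeg a + d) b
  simp only [homValue, ← hφ]
  simp [sub_eq_add_neg]

theorem listIns_sub_smul_right (d : ℤ) (F G G' : List (Σ i, E i) → ⨁ i, E i) (s : 𝕜)
    (l : List (Σ i, E i)) :
    listIns 𝕜 d F (fun l => G l - s • G' l) l =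
      listIns 𝕜 d F G l - s • listIns 𝕜 d F G' l := by
  unfold listIns
  rw [sub_eq_add_neg, ← neg_smul, ← unshuffle_smul, ← unshuffle_add]
  simp [sub_eq_add_neg]

theorem ListHomogeneous.listIns {dF dG : ℤ} (F : List (Σ i, E i) → ⨁ i, E i)
    {G : List (Σ i, E i) → ⨁ i, E i} (hG : ListHomogeneous dG G) :
    ListHomogeneous (dF + dG) (listIns 𝕜 dF F G) := by
  intro l m hm
  have h := map_unshuffle (𝕜 := 𝕜) (DirectSum.component 𝕜 ℤ E m) l
    (fun a b => G (homValue dF F a :: b))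
  refine h.trans ((unshuffle_congr (𝕜 := 𝕜) l fun a b hab => ?_).trans
    ((unshuffle_smul (0 : 𝕜) l fun _ _ => (0 : E m)).trans (zero_smul _ _)))
  rw [zero_smul]
  refine hG _ m fun h' => hm ?_
  rw [h']
  simp only [listDeg_cons, homValue]
  linarith

theorem listIns_cons_zero (d : ℤ) {F G : List (Σ i, E i) → ⨁ i, E i} (hF : HeadLinear 𝕜 F)
    (hG : HeadLinear 𝕜 G) (hG' : HeadSymm 𝕜 G) (m : ℤ) (l : List (Σ i, E i)) :
    listIns 𝕜 d F G (⟨m, 0⟩ :: l) = 0 := by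
  simp only [listIns, unshuffle, ← unshuffle_add]
  refine (unshuffle_congr (𝕜 := 𝕜) l fun a b _ => ?_).trans
    ((unshuffle_smul (0 : 𝕜) l fun _ _ => (0 : ⨁ i, E i)).trans (zero_smul _ _))
  rw [hG' (homValue d F a), hG.map_zero, homValue, hF.map_zero]
  simp [hG.map_zero]

/-- Inserting `K` and `L` separately into `M`. -/
theorem listIns_listIns (dK dL : ℤ) (K L : List (Σ i, E i) → ⨁ i, E i)
    {M : List (Σ i, E i) → ⨁ i, E i} (hM : HeadLinear 𝕜 M) (l : List (Σ i, E i)) :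
    listIns 𝕜 dK K (listIns 𝕜 dL L M) l =
      listIns 𝕜 (dK + dL) (listIns 𝕜 dK K L) M l +
        unshuffle 𝕜 l (fun a b => unshuffle 𝕜 b (fun c d =>
          (-1 : 𝕜) ^ ((listDeg a + dK) * listDeg c) •
            M (homValue dL L c :: homValue dK K a :: d))) := by
  conv_lhs => unfold listIns
  simp only [unshuffle, unshuffle_add]
  congr 1
  rw [← unshuffle_coassoc l fun a c d => M (homValue dL L (homValue dK K a :: c) :: d)]
  refine unshuffle_congr l fun e d _ => ?_
  obtain ⟨φ, hφ⟩ := hM.exists_linearMap (listDeg e + (dK + dL)) d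
  refine Eq.trans ?_ (hφ (listIns 𝕜 dK K L e))
  unfold listIns
  rw [map_unshuffle]
  refine unshuffle_congr e fun a c hac => ?_
  rw [hφ]
  have : listDeg (homValue dK K a :: c) + dL = listDeg e + (dK + dL) := by
    simp only [listDeg_cons, homValue]
    linarith
  rw [homValue, this]

/-- The associator of insertion is graded symmetric in the two inserted forms. -/
theorem listIns_associator (dK dL : ℤ) (K L : List (Σ i, E i) → ⨁ i, E i)
    {M : List (Σ i, E i) → ⨁ i, E i} (hM : HeadLinear 𝕜 M) (hM' : HeadSymm 𝕜 M)
    (l : List (Σ i, E i)) :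
    listIns 𝕜 dK K (listIns 𝕜 dL L M) l - listIns 𝕜 (dK + dL) (listIns 𝕜 dK K L) M l =
      (-1 : 𝕜) ^ (dK * dL) • (listIns 𝕜 dL L (listIns 𝕜 dK K M) l -
        listIns 𝕜 (dL + dK) (listIns 𝕜 dL L K) M l) := by
  rw [listIns_listIns dK dL K L hM, listIns_listIns dL dK L K hM, add_sub_cancel_left,
    add_sub_cancel_left, ← unshuffle_unshuffle_swap, ← unshuffle_smul]
  refine unshuffle_congr l fun a b _ => ?_
  rw [← unshuffle_smul]
  refine unshuffle_congr b fun c d _ => ?_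
  rw [hM' (homValue dL L a), smul_smul, smul_smul, smul_smul, neg_one_zpow_mul, neg_one_zpow_mul,
    neg_one_zpow_mul]
  congr 1
  simp only [homValue]
  exact neg_one_zpow_congr ⟨listDeg a * listDeg c + listDeg a * dK, by ring⟩

variable (𝕜) in
/-- The Richardson–Nijenhuis bracket of forms of degrees `dF` and `dG`, in terms of lists. -/
def listBracket (dF dG : ℤ) (F G : List (Σ i, E i) → ⨁ i, E i) (l : List (Σ i, E i)) :
    ⨁ i, E i :=
  listIns 𝕜 dF F G l - (-1 : 𝕜) ^ (dF * dG) • listIns 𝕜 dG G F l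

theorem ListHomogeneous.listBracket {dF dG : ℤ} {F G : List (Σ i, E i) → ⨁ i, E i}
    (hF : ListHomogeneous dF F) (hG : ListHomogeneous dG G) :
    ListHomogeneous (dF + dG) (listBracket 𝕜 dF dG F G) := by
  intro l m hm
  have h1 := hG.listIns (𝕜 := 𝕜) (dF := dF) F l m hm
  have h2 := hF.listIns (𝕜 := 𝕜) (dF := dG) G l m (by rwa [add_comm dG dF])
  change _ - (-1 : 𝕜) ^ (dF * dG) • _ = (0 : E m)
  rw [h1, h2, smul_zero, sub_zero]

theorem listBracket_cons_zero (dF dG : ℤ) {F G : List (Σ i, E i) → ⨁ i, E i}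
    (hF : HeadLinear 𝕜 F) (hF' : HeadSymm 𝕜 F) (hG : HeadLinear 𝕜 G) (hG' : HeadSymm 𝕜 G)
    (m : ℤ) (l : List (Σ i, E i)) : listBracket 𝕜 dF dG F G (⟨m, 0⟩ :: l) = 0 := by
  rw [listBracket, listIns_cons_zero dF hF hG hG', listIns_cons_zero dG hG hF hF', smul_zero,
    sub_zero]

theorem neg_one_zpow_eq_or (a : ℤ) : (-1 : 𝕜) ^ a = 1 ∨ (-1 : 𝕜) ^ a = -1 := by
  rcases Int.even_or_odd a with h | h
  · exact Or.inl h.neg_one_zpow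
  · exact Or.inr h.neg_one_zpow

theorem listBracket_antisymm (dK dL : ℤ) (K L : List (Σ i, E i) → ⨁ i, E i)
    (l : List (Σ i, E i)) :
    listBracket 𝕜 dK dL K L l = (-((-1 : 𝕜) ^ (dK * dL))) • listBracket 𝕜 dL dK L K l := by
  unfold listBracket
  rw [mul_comm dL dK]
  rcases neg_one_zpow_eq_or (𝕜 := 𝕜) (dK * dL) with h | h <;> rw [h] <;> module

theorem listBracket_jacobi (dK dL dM : ℤ) {K L M : List (Σ i, E i) → ⨁ i, E i}
    (hK : HeadLinear 𝕜 K) (hL : HeadLinear 𝕜 L) (hM : HeadLinear 𝕜 M)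
    (hK' : HeadSymm 𝕜 K) (hL' : HeadSymm 𝕜 L) (hM' : HeadSymm 𝕜 M) (l : List (Σ i, E i)) :
    listBracket 𝕜 dK (dL + dM) K (listBracket 𝕜 dL dM L M) l =
      listBracket 𝕜 (dK + dL) dM (listBracket 𝕜 dK dL K L) M l +
        (-1 : 𝕜) ^ (dK * dL) • listBracket 𝕜 dL (dK + dM) L (listBracket 𝕜 dK dM K M) l := by
  have h1 := listIns_associator dK dL K L hM hM' l
  have h2 := listIns_associator dK dM K M hL hL' l
  have h3 := listIns_associator dL dM L M hK hK' l
  unfold listBracket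
  simp only [listIns_sub_smul_left _ _ _ _ hK, listIns_sub_smul_left _ _ _ _ hL,
    listIns_sub_smul_left _ _ _ _ hM, listIns_sub_smul_right]
  rw [mul_add, mul_add, add_mul, mul_comm dL dK]
  simp only [← neg_one_zpow_mul]
  rw [add_comm dL dK, add_comm dM dK] at *
  rw [add_comm dM dL] at *
  have ha := neg_one_zpow_eq_or (𝕜 := 𝕜) (dK * dL)
  have hb := neg_one_zpow_eq_or (𝕜 := 𝕜) (dL * dM)
  have hc := neg_one_zpow_eq_or (𝕜 := 𝕜) (dK * dM)
  generalize (-1 : 𝕜) ^ (dK * dL) = a at *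
  generalize (-1 : 𝕜) ^ (dL * dM) = b at *
  generalize (-1 : 𝕜) ^ (dK * dM) = c at *
  linear_combination (norm := skip) h1 - b • h2 + (a * c) • h3
  rcases ha with rfl | rfl <;> rcases hb with rfl | rfl <;> rcases hc with rfl | rfl <;> module

end Lists

section Shuffles

variable {𝕜 : Type} [Field 𝕜]
variable {E : ℤ → Type}
variable {V : Type} [AddCommGroup V] [Module 𝕜 V]

/-- The increasing list of the elements of `Fin n` at which `f` is true. -/
def trueList {n : ℕ} (f : Fin n → Bool) : List (Fin n) := (List.finRange n).filter (fun i => f i)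

theorem mem_trueList {n : ℕ} (f : Fin n → Bool) (i : Fin n) : i ∈ trueList f ↔ f i = true := by
  simp [trueList]

theorem pairwise_trueList {n : ℕ} (f : Fin n → Bool) : (trueList f).Pairwise (· < ·) :=
  (List.pairwise_lt_finRange n).filter _

theorem eq_trueList {n : ℕ} (f : Fin n → Bool) {l : List (Fin n)} (h : l.Pairwise (· < ·))
    (hl : ∀ i, i ∈ l ↔ f i = true) : l = trueList f :=
  List.Pairwise.eq_of_mem_iff h (pairwise_trueList f) fun i => by rw [hl, mem_trueList]

theorem trueList_cons_true {n : ℕ} (f : Fin n → Bool) :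
    trueList (Fin.cons true f : Fin (n + 1) → Bool) = 0 :: (trueList f).map Fin.succ := by
  simp [trueList, List.finRange_succ, List.filter_map, Function.comp_def]

theorem trueList_cons_false {n : ℕ} (f : Fin n → Bool) :
    trueList (Fin.cons false f : Fin (n + 1) → Bool) = (trueList f).map Fin.succ := by
  simp [trueList, List.finRange_succ, List.filter_map, Function.comp_def]

variable (𝕜) in
/-- The Koszul sign of moving the arguments selected by `f` to the front. -/
def splitSign {n : ℕ} (ι : Fin n → ℤ) (f : Fin n → Bool) : 𝕜 :=
  ∏ i, ∏ j, if f i = true ∧ f j = false ∧ j < i then (-1 : 𝕜) ^ (ι i * ι j) else 1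

theorem prod_ite_neg_one_zpow {n : ℕ} (x : Fin n → Σ i, E i) (f : Fin n → Bool) (m : ℤ) :
    (∏ i, if f i = true then (-1 : 𝕜) ^ ((x i).1 * m) else 1) =
      (-1 : 𝕜) ^ (m * listDeg ((trueList f).map x)) := by
  induction n with
  | zero => simp [trueList]
  | succ n ih =>
    induction f using Fin.consCases with
    | cons b f =>
      rw [Fin.prod_univ_succ]
      simp only [Fin.cons_zero, Fin.cons_succ]
      rw [ih (fun i => x i.succ) f]
      cases b
      · rw [trueList_cons_false]; simp [Function.comp_def]
      · rw [trueList_cons_true]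
        simp only [if_true, List.map_cons, listDeg_cons, List.map_map, neg_one_zpow_mul]
        congr 1
        simp only [Function.comp_def]
        ring

theorem splitSign_cons_true {n : ℕ} (ι : Fin (n + 1) → ℤ) (f : Fin n → Bool) :
    splitSign 𝕜 ι (Fin.cons true f) = splitSign 𝕜 (fun i => ι i.succ) f := by
  simp [splitSign, Fin.prod_univ_succ]

theorem splitSign_cons_false {n : ℕ} (x : Fin (n + 1) → Σ i, E i) (f : Fin n → Bool) :
    splitSign 𝕜 (fun i => (x i).1) (Fin.cons false f) =
      (-1 : 𝕜) ^ ((x 0).1 * listDeg ((trueList f).map fun i => x i.succ)) *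
        splitSign 𝕜 (fun i => (x i.succ).1) f := by
  rw [← prod_ite_neg_one_zpow]
  simp only [splitSign, Fin.prod_univ_succ, Fin.cons_zero, Fin.cons_succ]
  rw [← Finset.prod_mul_distrib]
  simp

theorem sum_splitSign_smul {n : ℕ} (x : Fin n → Σ i, E i)
    (Φ : List (Σ i, E i) → List (Σ i, E i) → V) :
    ∑ f : Fin n → Bool, splitSign 𝕜 (fun i => (x i).1) f •
        Φ ((trueList f).map x) ((trueList fun i => !f i).map x) =
      unshuffle 𝕜 (List.ofFn x) Φ := by
  induction n generalizing Φ with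
  | zero => simp [splitSign, trueList, unshuffle]
  | succ n ih =>
    rw [← (Fin.consEquiv fun _ => Bool).sum_comp, Fintype.sum_prod_type, Fintype.sum_bool,
      List.ofFn_succ]
    simp only [unshuffle]
    rw [← ih, ← ih]
    have h : ∀ (b : Bool) (f : Fin n → Bool),
        (fun i => !((Fin.cons b f : Fin (n + 1) → Bool) i)) =
          (Fin.cons (!b) (fun i => !f i) : Fin (n + 1) → Bool) := by
      intro b f
      ext i
      cases i using Fin.cases <;> simp
    congr 1 <;> refine Finset.sum_congr rfl fun f _ => ?_
    · simp only [Fin.consEquiv, Equiv.coe_fn_mk, h, splitSign_cons_true, trueList_cons_true,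
        Bool.not_true, trueList_cons_false]
      simp [Function.comp_def]
    · simp only [Fin.consEquiv, Equiv.coe_fn_mk, h, splitSign_cons_false, trueList_cons_true,
        Bool.not_false, trueList_cons_false, List.map_map, List.map_cons, smul_smul]
      rw [mul_comm]
      rfl

/-- The arguments that a `(k, n-k)`-shuffle puts in the first `k` places. -/
def shuffleSet {n : ℕ} (k : ℕ) (σ : Equiv.Perm (Fin n)) (i : Fin n) : Bool :=
  decide ((σ.symm i : ℕ) < k)

theorem shuffleSet_apply {n : ℕ} (k : ℕ) (σ : Equiv.Perm (Fin n)) (i : Fin n) :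
    shuffleSet k σ (σ i) = true ↔ (i : ℕ) < k := by
  simp [shuffleSet]

theorem ofFn_shuffle_left {n k : ℕ} (hk : k ≤ n) {σ : Equiv.Perm (Fin n)} (hσ : IsShuffle k σ) :
    (List.ofFn fun i : Fin k => σ ⟨i, i.isLt.trans_le hk⟩) = trueList (shuffleSet k σ) := by
  refine eq_trueList _ ?_ fun i => ?_
  · rw [List.pairwise_ofFn]
    exact fun i j hij => hσ _ _ hij (Or.inl j.isLt)
  · rw [List.mem_ofFn]
    constructor
    · rintro ⟨j, rfl⟩
      exact (shuffleSet_apply _ _ _).2 j.isLt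
    · intro h
      simp only [shuffleSet, decide_eq_true_eq] at h
      exact ⟨⟨σ.symm i, h⟩, by simp⟩

theorem ofFn_shuffle_right {n k : ℕ} (hk : k ≤ n) {σ : Equiv.Perm (Fin n)}
    (hσ : IsShuffle k σ) :
    (List.ofFn fun i : Fin (n - k) => σ ⟨k + i, by omega⟩) =
      trueList (fun i => !shuffleSet k σ i) := by
  refine eq_trueList _ ?_ fun i => ?_
  · rw [List.pairwise_ofFn]
    exact fun i j hij => hσ _ _ (by simpa using hij) (Or.inr (by simp))
  · rw [List.mem_ofFn]
    constructor
    · rintro ⟨j, rfl⟩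
      simp [shuffleSet]
    · intro h
      simp only [shuffleSet, Bool.not_eq_true', decide_eq_false_iff_not, not_lt] at h
      exact ⟨⟨σ.symm i - k, by omega⟩, by simp [Nat.add_sub_cancel' h]⟩

theorem koszulSign_shuffle {n k : ℕ} (ι : Fin n → ℤ) {σ : Equiv.Perm (Fin n)}
    (hσ : IsShuffle k σ) : koszulSign 𝕜 ι σ = splitSign 𝕜 ι (shuffleSet k σ) := by
  have h : ∀ i j : Fin n, (i < j ∧ σ j < σ i) ↔
      (shuffleSet k σ (σ i) = true ∧ shuffleSet k σ (σ j) = false ∧ σ j < σ i) := by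
    intro i j
    rw [shuffleSet_apply, ← Bool.not_eq_true, shuffleSet_apply, not_lt]
    refine ⟨fun ⟨h1, h2⟩ => ?_, fun ⟨h1, h2, h3⟩ => ⟨Fin.lt_def.2 (h1.trans_le h2), h3⟩⟩
    by_contra hcon
    exact absurd (hσ i j h1 (by rw [Fin.lt_def] at h1; by_contra; apply hcon; omega)) h2.asymm
  unfold koszulSign splitSign
  rw [Finset.prod_filter, Fintype.prod_prod_type]
  refine Eq.trans ?_ (Equiv.prod_comp σ _)
  refine Finset.prod_congr rfl fun i _ => ?_
  refine Eq.trans ?_ (Equiv.prod_comp σ _)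
  refine Finset.prod_congr rfl fun j _ => ?_
  exact if_congr (h i j) rfl rfl

theorem exists_shuffle {n : ℕ} (f : Fin n → Bool) :
    ∃ (k : ℕ) (_ : k ≤ n) (σ : Equiv.Perm (Fin n)), IsShuffle k σ ∧ shuffleSet k σ = f := by
  set a := trueList f with ha
  set b := trueList (fun i => !f i) with hb
  have hmem : ∀ i, i ∈ a ++ b := fun i => by
    rw [List.mem_append, ha, hb, mem_trueList, mem_trueList]
    cases f i <;> simp
  have hnd : (a ++ b).Nodup := by
    refine List.nodup_append.2 ⟨(pairwise_trueList _).imp fun h => h.ne,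
      (pairwise_trueList _).imp fun h => h.ne, fun i hi j hj hij => ?_⟩
    subst hij
    rw [ha, mem_trueList] at hi
    rw [hb, mem_trueList, hi] at hj
    simp at hj
  let e := hnd.getEquivOfForallMemList _ hmem
  have hlen : (a ++ b).length = n := by simpa using Fintype.card_congr e
  have hlen' : a.length + b.length = n := by simpa using hlen
  refine ⟨a.length, by omega, (finCongr hlen.symm).trans e, ?_, ?_⟩
  · rintro i j hij (hj | hi)
    · have hi : (i : ℕ) < a.length := lt_trans hij hj
      simpa [e, List.getElem_append_left, hi, hj] using
        List.pairwise_iff_getElem.1 (pairwise_trueList f) i j hi hj hij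
    · have hj : a.length ≤ (j : ℕ) := hi.trans (le_of_lt hij)
      have := List.pairwise_iff_getElem.1 (pairwise_trueList fun i => !f i) (i - a.length)
        (j - a.length) (by rw [← hb]; omega) (by rw [← hb]; omega)
        (by rw [Fin.lt_def] at hij; omega)
      simpa [e, List.getElem_append_right, hi, hj] using this
  · ext i
    obtain ⟨j, rfl⟩ := ((finCongr hlen.symm).trans e).surjective i
    rw [Bool.eq_iff_iff, shuffleSet_apply]
    by_cases hj : (j : ℕ) < a.length
    · have := (mem_trueList f _).1 (List.getElem_mem (l := a) hj)
      simpa [e, List.getElem_append_left, hj] using this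
    · have hj' : (j : ℕ) - a.length < b.length := by omega
      have := (mem_trueList (fun i => !f i) _).1 (List.getElem_mem (l := b) hj')
      simpa [e, List.getElem_append_right, hj, not_lt.1 hj] using this

/-- The sum over shuffles in terms of splittings of lists. -/
theorem sum_shuffle {n : ℕ} (x : Fin n → Σ i, E i)
    (Φ : List (Σ i, E i) → List (Σ i, E i) → V) :
    ∑ k : Fin (n + 1), ∑ σ ∈ Finset.univ.filter
        (fun σ : Equiv.Perm (Fin n) => IsShuffle (k : ℕ) σ),
      koszulSign 𝕜 (fun i => (x i).1) σ •
        Φ (List.ofFn fun i : Fin k => x (σ ⟨i, i.isLt.trans_le (Nat.le_of_lt_succ k.isLt)⟩))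
          (List.ofFn fun i : Fin (n - k) => x (σ ⟨k + i, by omega⟩)) =
      unshuffle 𝕜 (List.ofFn x) Φ := by
  rw [← sum_splitSign_smul, Finset.sum_sigma']
  refine Finset.sum_bij (fun p _ => shuffleSet p.1 p.2) (fun _ _ => Finset.mem_univ _) ?_ ?_ ?_
  · rintro ⟨⟨k, hk⟩, σ⟩ hσ ⟨⟨k', hk'⟩, τ⟩ hτ h
    simp only [Finset.mem_sigma, Finset.mem_univ, Finset.mem_filter, true_and] at hσ hτ h
    have hk := Nat.le_of_lt_succ hk
    have hk' := Nat.le_of_lt_succ hk'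
    have h1 := (ofFn_shuffle_left hk hσ).trans
      ((congrArg trueList h).trans (ofFn_shuffle_left hk' hτ).symm)
    obtain rfl : k = k' := by simpa using congrArg List.length h1
    have h2 := (ofFn_shuffle_right hk hσ).trans
      ((congrArg (fun f => trueList fun i => !f i) h).trans (ofFn_shuffle_right hk hτ).symm)
    have h1 := List.ofFn_injective h1
    have h2 := List.ofFn_injective h2
    have : σ = τ := by
      ext1 i
      by_cases hi : (i : ℕ) < k
      · exact congrFun h1 ⟨i, hi⟩
      · have := congrFun h2 ⟨i - k, by omega⟩
        simpa [Nat.add_sub_cancel' (not_lt.1 hi)] using this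
    rw [this]
  · intro f _
    obtain ⟨k, hk, σ, hσ, hf⟩ := exists_shuffle f
    exact ⟨⟨⟨k, Nat.lt_succ_of_le hk⟩, σ⟩, by simpa using hσ, hf⟩
  · rintro ⟨⟨k, hk⟩, σ⟩ hσ
    simp only [Finset.mem_sigma, Finset.mem_univ, Finset.mem_filter, true_and] at hσ
    have hk := Nat.le_of_lt_succ hk
    simp only [koszulSign_shuffle _ hσ]
    rw [← ofFn_shuffle_left hk hσ, ← ofFn_shuffle_right hk hσ, List.map_ofFn, List.map_ofFn]
    rfl

end Shuffles

section RawForms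

variable {𝕜 : Type} [Field 𝕜]
variable {E : ℤ → Type} [∀ i, AddCommGroup (E i)] [∀ i, Module 𝕜 (E i)]

/-- A raw form as a function of lists of homogeneous elements. -/
def onList (F : RawForm E) (l : List (Σ i, E i)) : ⨁ i, E i :=
  F l.length (fun i => (l.get i).1) (fun i => (l.get i).2)

theorem onList_ofFn (F : RawForm E) {n : ℕ} (ι : Fin n → ℤ) (x : ∀ j, E (ι j)) :
    onList F (List.ofFn fun i => (⟨ι i, x i⟩ : Σ i, E i)) = F n ι x :=
  congrArg (fun p : Σ n, Fin n → Σ i, E i => F p.1 (fun i => (p.2 i).1) (fun i => (p.2 i).2))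
    ((List.equivSigmaTuple (α := Σ i, E i)).apply_symm_apply ⟨n, fun i => ⟨ι i, x i⟩⟩)

theorem rawForm_ext {F G : RawForm E} (h : ∀ l, onList F l = onList G l) : F = G := by
  funext n ι x
  rw [← onList_ofFn F ι x, ← onList_ofFn G ι x, h]

theorem onList_dcons (G : RawForm E) {n : ℕ} {m : ℤ} {ι : Fin n → ℤ} (v : E m)
    (x : ∀ j, E (ι j)) :
    G (n + 1) (dcons m ι) (dconsV E v x) =
      onList G (⟨m, v⟩ :: List.ofFn fun i => (⟨ι i, x i⟩ : Σ i, E i)) := by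
  rw [← onList_ofFn G, List.ofFn_succ]
  rfl

theorem headLinear_onList {F : RawForm E} (hF : IsMultilin 𝕜 E F) :
    HeadLinear 𝕜 (onList F) := by
  intro m b
  let ι : Fin (b.length + 1) → ℤ := Fin.cons m fun i => (b.get i).1
  let x (v : E m) : ∀ j, E (ι j) :=
    Fin.cons (α := fun j => E (ι j)) v fun i => (b.get i).2
  have hx : ∀ v, F _ ι (x v) = onList F (⟨m, v⟩ :: b) := fun v => by
    rw [← onList_ofFn F, List.ofFn_succ]
    congr 2
    exact List.ofFn_get b
  have hu : ∀ v w, Function.update (x v) 0 w = x w := fun v w =>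
    Fin.update_cons_zero (α := fun j => E (ι j)) v _ w
  refine ⟨{ toFun := fun v => F _ ι (x v), map_add' := fun v w => ?_, map_smul' := fun c v => ?_ },
    hx⟩
  · refine (congrArg (F _ ι) (hu 0 (v + w))).symm.trans ((hF _ ι (x 0) 0 v w 0).1.trans ?_)
    exact congrArg₂ (fun y z => F _ ι y + F _ ι z) (hu 0 v) (hu 0 w)
  · refine (congrArg (F _ ι) (hu 0 (c • v))).symm.trans ((hF _ ι (x 0) 0 v 0 c).2.trans ?_)
    exact congrArg (fun y => c • F _ ι y) (hu 0 v)

theorem headSymm_onList {F : RawForm E} (hF : IsGradedSym 𝕜 E F) : HeadSymm 𝕜 (onList F) := by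
  intro u w b
  refine Eq.trans ?_ (hF _ (fun i => ((w :: u :: b).get i).1) (fun i => ((w :: u :: b).get i).2)
    (0 : Fin (b.length + 2)) (1 : Fin (b.length + 2)) rfl)
  rw [← onList_ofFn F]
  congr 1
  refine List.ext_getElem (by simp) fun i hi hi' => ?_
  rw [List.getElem_ofFn]
  match i with
  | 0 => rfl
  | 1 => simp
  | i + 2 =>
    have h : Equiv.swap (0 : Fin (b.length + 2)) 1 ⟨i + 2, by simpa using hi⟩ =
        ⟨i + 2, by simpa using hi⟩ :=
      Equiv.swap_apply_of_ne_of_ne (by simp [Fin.ext_iff]) (by simp [Fin.ext_iff])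
    exact (congrArg (w :: u :: b).get h).symm

theorem listHomogeneous_onList {d : ℤ} {F : RawForm E} (hF : IsOfDeg E d F) :
    ListHomogeneous d (onList F) := by
  intro l m hm
  refine hF _ _ _ m ?_
  have : ∑ j : Fin l.length, (l.get j).1 = listDeg l := by
    rw [listDeg, ← List.sum_ofFn, ← Function.comp_def Sigma.fst l.get,
      ← List.map_ofFn, List.ofFn_get]
  rwa [this]

theorem dfinsupp_sum_eq {d : ℤ} {F : List (Σ i, E i) → ⨁ i, E i} (hF : ListHomogeneous d F)
    {G : List (Σ i, E i) → ⨁ i, E i} (hG : ∀ m b, G (⟨m, 0⟩ :: b) = 0) (a b : List (Σ i, E i)) :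
    DFinsupp.sum (F a) (fun m v => G (⟨m, v⟩ :: b)) = G (homValue d F a :: b) := by
  have h : F a = DFinsupp.single (listDeg a + d) (F a (listDeg a + d)) := by
    refine DFinsupp.ext fun m => ?_
    by_cases hm : m = listDeg a + d
    · subst hm
      rw [DFinsupp.single_eq_same]
    · rw [DFinsupp.single_eq_of_ne hm]
      exact hF a m hm
  rw [h]
  refine (DFinsupp.sum_single_index (h := fun m v => G (⟨m, v⟩ :: b)) ?_).trans ?_
  · exact hG _ _
  · simp [homValue]

theorem onList_ins {d : ℤ} {F G : RawForm E} (hF : ListHomogeneous d (onList F))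
    (hG : ∀ m b, onList G (⟨m, 0⟩ :: b) = 0) (l : List (Σ i, E i)) :
    onList (ins 𝕜 E F G) l = listIns 𝕜 d (onList F) (onList G) l := by
  rw [show onList (ins 𝕜 E F G) l = ins 𝕜 E F G _ _ _ from rfl, ins, listIns]
  conv_rhs => rw [← List.ofFn_get l]
  rw [← sum_shuffle]
  refine Finset.sum_congr rfl fun k _ => Finset.sum_congr rfl fun σ _ => ?_
  congr 1
  rw [← dfinsupp_sum_eq hF hG]
  simp only [onList_dcons]
  rw [← onList_ofFn F]

theorem onList_rnb {dF dG : ℤ} {F G : RawForm E} (hF : ListHomogeneous dF (onList F))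
    (hG : ListHomogeneous dG (onList G)) (hF' : ∀ m b, onList F (⟨m, 0⟩ :: b) = 0)
    (hG' : ∀ m b, onList G (⟨m, 0⟩ :: b) = 0) :
    onList (rnb 𝕜 E dF dG F G) = listBracket 𝕜 dF dG (onList F) (onList G) := by
  funext l
  unfold listBracket
  rw [← onList_ins hF hG', ← onList_ins hG hF']
  rfl

end RawForms

/-- The space of symmetric vector valued forms on a ℤ-graded vector space,
equipped with the Richardson–Nijenhuis bracket, is a graded Lie algebra: graded antisymmetry
`[K,L] = -(-1)^{K̄L̄}[L,K]` and the graded Jacobi identity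
`[K,[L,M]] = [[K,L],M] + (-1)^{K̄L̄}[L,[K,M]]`. -/
theorem statement0 (𝕜 : Type) [Field 𝕜] [CharZero 𝕜]
    (E : ℤ → Type) [∀ i, AddCommGroup (E i)] [∀ i, Module 𝕜 (E i)]
    (dK dL dM : ℤ) (K L M : RawForm E)
    (hK : IsSVF 𝕜 E dK K) (hL : IsSVF 𝕜 E dL L) (hM : IsSVF 𝕜 E dM M) :
    rnb 𝕜 E dK dL K L = (-((-1 : 𝕜) ^ (dK * dL))) • rnb 𝕜 E dL dK L K ∧
      rnb 𝕜 E dK (dL + dM) K (rnb 𝕜 E dL dM L M) =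
        rnb 𝕜 E (dK + dL) dM (rnb 𝕜 E dK dL K L) M +
          ((-1 : 𝕜) ^ (dK * dL)) • rnb 𝕜 E dL (dK + dM) L (rnb 𝕜 E dK dM K M) := by
  have hK₁ := headLinear_onList hK.1
  have hL₁ := headLinear_onList hL.1
  have hM₁ := headLinear_onList hM.1
  have hK₂ := listHomogeneous_onList hK.2.2
  have hL₂ := listHomogeneous_onList hL.2.2
  have hM₂ := listHomogeneous_onList hM.2.2
  have hK₃ := headSymm_onList hK.2.1
  have hL₃ := headSymm_onList hL.2.1
  have hM₃ := headSymm_onList hM.2.1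
  have hKL := onList_rnb (𝕜 := 𝕜) hK₂ hL₂ hK₁.map_zero hL₁.map_zero
  have hLM := onList_rnb (𝕜 := 𝕜) hL₂ hM₂ hL₁.map_zero hM₁.map_zero
  have hKM := onList_rnb (𝕜 := 𝕜) hK₂ hM₂ hK₁.map_zero hM₁.map_zero
  refine ⟨rawForm_ext fun l => ?_, rawForm_ext fun l => ?_⟩
  · have h := listBracket_antisymm (𝕜 := 𝕜) dK dL (onList K) (onList L) l
    rw [← hKL, ← onList_rnb hL₂ hK₂ hL₁.map_zero hK₁.map_zero] at h
    exact h
  · have h := listBracket_jacobi dK dL dM hK₁ hL₁ hM₁ hK₃ hL₃ hM₃ l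
    rw [← hKL, ← hLM, ← hKM,
      ← onList_rnb hK₂ (hLM ▸ hL₂.listBracket hM₂) hK₁.map_zero
        (hLM ▸ listBracket_cons_zero dL dM hL₁ hL₃ hM₁ hM₃),
      ← onList_rnb (hKL ▸ hK₂.listBracket hL₂) hM₂
        (hKL ▸ listBracket_cons_zero dK dL hK₁ hK₃ hL₁ hL₃) hM₁.map_zero,
      ← onList_rnb hL₂ (hKM ▸ hK₂.listBracket hM₂) hL₁.map_zero
        (hKM ▸ listBracket_cons_zero dK dM hK₁ hK₃ hM₁ hM₃)] at h
    exact h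

end RN
end
end

section
/- Let μ be a symmetric vector valued form of degree 1 on a ℤ-graded vector space E with [μ,μ]_RN = 0 (for instance a curved L∞-structure), and let 𝒩 be a symmetric vector valued form of degree 0 on E. If 𝒩 is Nijenhuis with respect to μ (i.e. admits a square 𝒦), then 𝒩 is weak Nijenhuis with respect to μ, i.e. [μ,[𝒩,[𝒩,μ]_RN]_RN]_RN = 0. -/
open scoped DirectSum
open Classical

noncomputable section

namespace RN

section ListForms

theorem update_eq_mk {E : ℤ → Type} {n : ℕ} (y : Fin n → Σ i, E i) (j : Fin n) (c : E (y j).1) :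
    Function.update y j ⟨(y j).1, c⟩ =
      fun t => (⟨(y t).1, Function.update (fun s => (y s).2) j c t⟩ : Σ i, E i) := by
  funext t
  by_cases h : t = j
  · subst h
    simp
  · simp [h]

theorem append_cons_eq_ofFn {α : Type*} (l r : List α) (Z Z' : α) :
    l ++ Z :: r = List.ofFn (Function.update (l ++ Z' :: r).get ⟨l.length, by simp⟩ Z) := by
  refine List.ext_getElem (by simp only [List.length_append, List.length_cons, List.length_ofFn])
    fun i h₁ h₂ => ?_
  rw [List.getElem_ofFn]
  rcases lt_trichotomy i l.length with h | h | h
  · rw [Function.update_of_ne (by simp [Fin.ext_iff, h.ne])]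
    simp [h]
  · subst h
    simp
  · rw [Function.update_of_ne (by simp [Fin.ext_iff, h.ne'])]
    simp [List.getElem_append, h.not_gt, List.getElem_cons, Nat.sub_ne_zero_of_lt h]

/-- Raw vector valued forms as functions of lists of homogeneous elements. -/
abbrev ListForm (E : ℤ → Type) [∀ i, AddCommGroup (E i)] : Type :=
  List (Σ i, E i) → ⨁ i, E i

variable {𝕜 : Type} [Field 𝕜]
variable {E : ℤ → Type} [∀ i, AddCommGroup (E i)] [∀ i, Module 𝕜 (E i)]

namespace RawForm

/-- The list form underlying a raw form. -/
def toList (F : RawForm E) : ListForm E :=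
  fun l => F l.length (fun j => (l.get j).1) (fun j => (l.get j).2)

theorem toList_ofFn (F : RawForm E) {n : ℕ} (y : Fin n → Σ i, E i) :
    toList F (List.ofFn y) = F n (fun j => (y j).1) (fun j => (y j).2) := by
  have h := List.equivSigmaTuple.apply_symm_apply (⟨n, y⟩ : Σ n, Fin n → Σ i, E i)
  exact congrArg (fun s : Σ n, Fin n → Σ i, E i =>
    F s.1 (fun j => (s.2 j).1) (fun j => (s.2 j).2)) h

theorem toList_injective : Function.Injective (toList : RawForm E → ListForm E) := by
  intro F G h
  funext n ι x
  simpa only [toList_ofFn] using congrFun h (List.ofFn fun j => (⟨ι j, x j⟩ : Σ i, E i))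

theorem toList_cons (F : RawForm E) {n : ℕ} (ι : Fin n → ℤ) (x : ∀ j, E (ι j)) (m : ℤ) (v : E m) :
    toList F (⟨m, v⟩ :: List.ofFn fun j => (⟨ι j, x j⟩ : Σ i, E i)) =
      F (n + 1) (dcons m ι) (dconsV E v x) := by
  have h : (⟨m, v⟩ :: List.ofFn fun j => (⟨ι j, x j⟩ : Σ i, E i)) =
      List.ofFn fun j => (⟨dcons m ι j, dconsV E v x j⟩ : Σ i, E i) := by
    rw [List.ofFn_succ]
    rfl
  rw [h, toList_ofFn]

end RawForm

namespace ListForm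

/-- Contraction with a homogeneous element in the first slot. -/
def contract (X : Σ i, E i) (F : ListForm E) : ListForm E := fun l => F (X :: l)

/-- Additivity and homogeneity in each slot. -/
def Multilinear (𝕜 : Type) [Field 𝕜] [∀ i, Module 𝕜 (E i)] (F : ListForm E) : Prop :=
  ∀ (l r : List (Σ i, E i)) (i : ℤ) (a b : E i) (c : 𝕜),
    F (l ++ ⟨i, a + b⟩ :: r) = F (l ++ ⟨i, a⟩ :: r) + F (l ++ ⟨i, b⟩ :: r) ∧
      F (l ++ ⟨i, c • a⟩ :: r) = c • F (l ++ ⟨i, a⟩ :: r)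

/-- Graded symmetry under swaps of adjacent list entries. -/
def Symmetric (𝕜 : Type) [Field 𝕜] [∀ i, Module 𝕜 (E i)] (F : ListForm E) : Prop :=
  ∀ (l r : List (Σ i, E i)) (X Y : Σ i, E i),
    F (l ++ Y :: X :: r) = ((-1 : 𝕜) ^ (X.1 * Y.1)) • F (l ++ X :: Y :: r)

/-- The form has degree `d`. -/
def HasDegree (d : ℤ) (F : ListForm E) : Prop :=
  ∀ (l : List (Σ i, E i)) (m : ℤ), m ≠ (l.map Sigma.fst).sum + d → F l m = 0

theorem Multilinear.contract {F : ListForm E} (h : F.Multilinear 𝕜) (X : Σ i, E i) :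
    (F.contract X).Multilinear 𝕜 := fun l => h (X :: l)

theorem Symmetric.contract {F : ListForm E} (h : F.Symmetric 𝕜) (X : Σ i, E i) :
    (F.contract X).Symmetric 𝕜 := fun l => h (X :: l)

theorem HasDegree.contract {F : ListForm E} {d : ℤ} (h : F.HasDegree d) (X : Σ i, E i) :
    (F.contract X).HasDegree (d + X.1) := fun l m hm => h (X :: l) m <| by
  simpa [add_comm, add_left_comm, add_assoc] using hm

theorem Symmetric.contract_contract {F : ListForm E} (h : F.Symmetric 𝕜) (X Y : Σ i, E i) :
    (F.contract Y).contract X = ((-1 : 𝕜) ^ (X.1 * Y.1)) • (F.contract X).contract Y :=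
  funext fun r => h [] r X Y

/-- Evaluate a form on a possibly inhomogeneous first argument. -/
def plug (G : ListForm E) (w : ⨁ i, E i) (l : List (Σ i, E i)) : ⨁ i, E i :=
  DFinsupp.sum w fun m v => G (⟨m, v⟩ :: l)

theorem Multilinear.cons_add {G : ListForm E} (h : G.Multilinear 𝕜) (l : List (Σ i, E i))
    (i : ℤ) (a b : E i) : G (⟨i, a + b⟩ :: l) = G (⟨i, a⟩ :: l) + G (⟨i, b⟩ :: l) :=
  (h [] l i a b 0).1

theorem Multilinear.cons_smul {G : ListForm E} (h : G.Multilinear 𝕜) (l : List (Σ i, E i))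
    (i : ℤ) (c : 𝕜) (a : E i) : G (⟨i, c • a⟩ :: l) = c • G (⟨i, a⟩ :: l) :=
  (h [] l i a 0 c).2

theorem Multilinear.cons_zero {G : ListForm E} (h : G.Multilinear 𝕜) (l : List (Σ i, E i))
    (i : ℤ) : G (⟨i, 0⟩ :: l) = 0 := by
  simpa using h.cons_smul l i 0 0

theorem Multilinear.plug_add {G : ListForm E} (h : G.Multilinear 𝕜) (v w : ⨁ i, E i)
    (l : List (Σ i, E i)) : G.plug (v + w) l = G.plug v l + G.plug w l :=
  DFinsupp.sum_add_index (fun i => h.cons_zero l i) (fun i => h.cons_add l i)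

theorem Multilinear.plug_smul {G : ListForm E} (h : G.Multilinear 𝕜) (c : 𝕜) (w : ⨁ i, E i)
    (l : List (Σ i, E i)) : G.plug (c • w) l = c • G.plug w l := by
  have h0 : G.plug 0 l = 0 := DFinsupp.sum_zero_index
  have hof : ∀ i (x : E i), G.plug (DirectSum.of E i x) l = G (⟨i, x⟩ :: l) := fun i x =>
    DFinsupp.sum_single_index (h.cons_zero l i)
  induction w using DirectSum.induction_on with
  | zero => rw [smul_zero, h0, smul_zero]
  | of i x =>
    have hc : c • DirectSum.of E i x = DirectSum.of E i (c • x) :=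
      ((DirectSum.lof 𝕜 ℤ E i).map_smul c x).symm
    rw [hc, hof, hof, h.cons_smul]
  | add v w hv hw => rw [smul_add, h.plug_add, h.plug_add, hv, hw, smul_add]

theorem Multilinear.plug_sum {G : ListForm E} (h : G.Multilinear 𝕜) {α : Type*} (s : Finset α)
    (f : α → ⨁ i, E i) (l : List (Σ i, E i)) :
    G.plug (∑ a ∈ s, f a) l = ∑ a ∈ s, G.plug (f a) l :=
  map_sum (AddMonoidHom.mk' (fun w => G.plug w l) fun v w => h.plug_add v w l) f s

theorem add_plug (G G' : ListForm E) (w : ⨁ i, E i) (l : List (Σ i, E i)) :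
    (G + G').plug w l = G.plug w l + G'.plug w l :=
  DFinsupp.sum_add

theorem smul_plug (c : 𝕜) (G : ListForm E) (w : ⨁ i, E i) (l : List (Σ i, E i)) :
    (c • G).plug w l = c • G.plug w l := by
  simp [plug, DFinsupp.sum, Finset.smul_sum]

/-- The insertion of a form of degree `f` into another one, defined by recursion: contraction with
a homogeneous element is a graded derivation of the insertion. -/
def insert (𝕜 : Type) [Field 𝕜] [∀ i, Module 𝕜 (E i)] :
    ℤ → ListForm E → ListForm E → ListForm E
  | _, F, G, [] => G.plug (F []) []
  | f, F, G, X :: l => insert 𝕜 (f + X.1) (F.contract X) G l +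
      ((-1 : 𝕜) ^ (X.1 * f)) • insert 𝕜 f F (G.contract X) l

theorem contract_add (F G : ListForm E) (X : Σ i, E i) :
    (F + G).contract X = F.contract X + G.contract X := rfl

theorem contract_sub (F G : ListForm E) (X : Σ i, E i) :
    (F - G).contract X = F.contract X - G.contract X := rfl

theorem contract_smul (c : 𝕜) (F : ListForm E) (X : Σ i, E i) :
    (c • F).contract X = c • F.contract X := rfl

theorem contract_insert (f : ℤ) (F G : ListForm E) (X : Σ i, E i) :
    (insert 𝕜 f F G).contract X = insert 𝕜 (f + X.1) (F.contract X) G +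
      ((-1 : 𝕜) ^ (X.1 * f)) • insert 𝕜 f F (G.contract X) :=
  funext fun l => by simp [contract, insert]

theorem insert_add_right (f : ℤ) (F G G' : ListForm E) :
    insert 𝕜 f F (G + G') = insert 𝕜 f F G + insert 𝕜 f F G' := by
  funext l
  induction l generalizing f F G G' with
  | nil => simp only [insert, Pi.add_apply, add_plug]
  | cons X l ih =>
    simp only [insert, Pi.add_apply, contract_add, ih, smul_add]
    abel

theorem insert_smul_right (f : ℤ) (c : 𝕜) (F G : ListForm E) :
    insert 𝕜 f F (c • G) = c • insert 𝕜 f F G := by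
  funext l
  induction l generalizing f F G with
  | nil => simp only [insert, Pi.smul_apply, smul_plug]
  | cons X l ih =>
    simp only [insert, Pi.smul_apply, contract_smul, ih, smul_add, smul_comm c]

theorem insert_add_left (f : ℤ) (F F' : ListForm E) {G : ListForm E} (hG : G.Multilinear 𝕜) :
    insert 𝕜 f (F + F') G = insert 𝕜 f F G + insert 𝕜 f F' G := by
  funext l
  induction l generalizing f F F' G with
  | nil => simp only [insert, Pi.add_apply, hG.plug_add]
  | cons X l ih =>
    simp only [insert, Pi.add_apply] at ih ⊢
    rw [contract_add, ih _ _ _ hG, ih _ _ _ (hG.contract X), smul_add]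
    abel

theorem insert_smul_left (f : ℤ) (c : 𝕜) (F : ListForm E) {G : ListForm E}
    (hG : G.Multilinear 𝕜) : insert 𝕜 f (c • F) G = c • insert 𝕜 f F G := by
  funext l
  induction l generalizing f F G with
  | nil => simp only [insert, Pi.smul_apply, hG.plug_smul]
  | cons X l ih =>
    simp only [insert, Pi.smul_apply] at ih ⊢
    rw [contract_smul, ih _ _ hG, ih _ _ (hG.contract X), smul_add, smul_comm c]

theorem insert_zero_right (f : ℤ) (F : ListForm E) : insert 𝕜 f F 0 = 0 := by
  simpa using insert_smul_right f (0 : 𝕜) F 0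

theorem insert_zero_left (f : ℤ) {G : ListForm E} (hG : G.Multilinear 𝕜) :
    insert 𝕜 f 0 G = 0 := by
  simpa using insert_smul_left f (0 : 𝕜) 0 hG

theorem insert_sub_right (f : ℤ) (F G G' : ListForm E) :
    insert 𝕜 f F (G - G') = insert 𝕜 f F G - insert 𝕜 f F G' := by
  have h : G - G' = G + (-1 : 𝕜) • G' := by rw [neg_one_smul, sub_eq_add_neg]
  rw [h, insert_add_right, insert_smul_right, neg_one_smul, sub_eq_add_neg]

theorem insert_sub_left (f : ℤ) (F F' : ListForm E) {G : ListForm E} (hG : G.Multilinear 𝕜) :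
    insert 𝕜 f (F - F') G = insert 𝕜 f F G - insert 𝕜 f F' G := by
  have h : F - F' = F + (-1 : 𝕜) • F' := by rw [neg_one_smul, sub_eq_add_neg]
  rw [h, insert_add_left _ _ _ hG, insert_smul_left _ _ _ hG, neg_one_smul, sub_eq_add_neg]

theorem neg_one_zpow_congr {a b : ℤ} (c : ℤ) (h : a = b + 2 * c) :
    (-1 : 𝕜) ^ a = (-1 : 𝕜) ^ b := by
  rw [h, zpow_add₀ (by simp), zpow_mul]
  simp

theorem neg_one_zpow_mul (a b : ℤ) : (-1 : 𝕜) ^ a * (-1 : 𝕜) ^ b = (-1 : 𝕜) ^ (a + b) :=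
  (zpow_add₀ (by simp) a b).symm

theorem insert_symmetric {f : ℤ} {F G : ListForm E} (hF : F.Symmetric 𝕜) (hG : G.Symmetric 𝕜)
    (hGm : G.Multilinear 𝕜) : (insert 𝕜 f F G).Symmetric 𝕜 := by
  intro l
  induction l generalizing f F G with
  | nil =>
    intro r X Y
    have key : ((insert 𝕜 f F G).contract Y).contract X =
        ((-1 : 𝕜) ^ (X.1 * Y.1)) • ((insert 𝕜 f F G).contract X).contract Y := by
      simp only [contract_insert, contract_add, contract_smul, smul_add, smul_smul]
      rw [hF.contract_contract X Y, hG.contract_contract X Y, insert_smul_left _ _ _ hGm,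
        insert_smul_right, add_right_comm f Y.1 X.1]
      simp only [smul_smul, neg_one_zpow_mul]
      rw [neg_one_zpow_congr (𝕜 := 𝕜) (a := X.1 * (f + Y.1)) (b := X.1 * Y.1 + X.1 * f) 0 (by ring),
        neg_one_zpow_congr (𝕜 := 𝕜) (a := X.1 * Y.1 + Y.1 * (f + X.1)) (b := Y.1 * f) (X.1 * Y.1)
          (by ring),
        neg_one_zpow_congr (𝕜 := 𝕜) (a := Y.1 * f + X.1 * f + X.1 * Y.1)
          (b := X.1 * Y.1 + (X.1 * f + Y.1 * f)) 0 (by ring)]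
      abel
    exact congrFun key r
  | cons Z l ih =>
    intro r X Y
    have h1 := ih (f := f + Z.1) (hF.contract Z) hG hGm r X Y
    have h2 := ih (f := f) hF (hG.contract Z) (hGm.contract Z) r X Y
    simp only [List.cons_append, insert, h1, h2, smul_add]
    rw [smul_comm]

theorem plug_apply_eq_zero {G : ListForm E} {w : ⨁ i, E i} {l : List (Σ i, E i)} {m : ℤ}
    (h : ∀ i, w i ≠ 0 → G (⟨i, w i⟩ :: l) m = 0) : G.plug w l m = 0 := by
  simp only [plug, DFinsupp.sum]
  rw [DFinsupp.finsetSum_apply]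
  exact Finset.sum_eq_zero fun i hi => h i (DFinsupp.mem_support_iff.mp hi)

theorem insert_hasDegree {f g : ℤ} {F G : ListForm E} (hF : F.HasDegree f) (hG : G.HasDegree g) :
    (insert 𝕜 f F G).HasDegree (f + g) := by
  intro l
  induction l generalizing f g F G with
  | nil =>
    intro m hm
    refine plug_apply_eq_zero fun i hi => hG _ _ fun h => ?_
    have : i = f := by
      by_contra hne
      exact hi (hF [] i (by simpa using hne))
    simp_all
  | cons X l ih =>
    intro m hm
    simp only [List.map_cons, List.sum_cons] at hm
    have h1 := ih (hF.contract X) hG m (fun h => hm (by rw [h]; ring))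
    have h2 := ih hF (hG.contract X) m (fun h => hm (by rw [h]; ring))
    simp only [insert]
    rw [DirectSum.add_apply, DirectSum.smul_apply, h1, h2]
    simp

/-- Insertion is graded right symmetric: the associator is graded symmetric in the two inserted
forms. -/
theorem insert_associator {f h : ℤ} {F G H : ListForm E} (hF : F.HasDegree f) (hH : H.HasDegree h)
    (hG : G.Symmetric 𝕜) (hGm : G.Multilinear 𝕜) (hFm : F.Multilinear 𝕜)
    (hHm : H.Multilinear 𝕜) :
    insert 𝕜 h H (insert 𝕜 f F G) - insert 𝕜 (h + f) (insert 𝕜 h H F) G =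
      ((-1 : 𝕜) ^ (f * h)) •
        (insert 𝕜 f F (insert 𝕜 h H G) - insert 𝕜 (f + h) (insert 𝕜 f F H) G) := by
  funext l
  induction l generalizing f h F G H with
  | nil =>
    have base : ∀ {f h : ℤ} {F H : ListForm E}, H.HasDegree h →
        (insert 𝕜 h H (insert 𝕜 f F G) - insert 𝕜 (h + f) (insert 𝕜 h H F) G) [] =
        ((-1 : 𝕜) ^ (h * f)) • ∑ i ∈ DFinsupp.support (H []),
          ∑ j ∈ DFinsupp.support (F []), G [⟨i, H [] i⟩, ⟨j, F [] j⟩] := by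
      intro f h F H hH
      have e1 : insert 𝕜 (h + f) (insert 𝕜 h H F) G [] =
          ∑ i ∈ DFinsupp.support (H []), G.plug (F [⟨i, H [] i⟩]) [] := by
        simp only [insert]
        rw [← hGm.plug_sum]
        rfl
      rw [Pi.sub_apply, e1, sub_eq_iff_eq_add', Finset.smul_sum, ← Finset.sum_add_distrib]
      simp only [insert, plug, DFinsupp.sum]
      refine Finset.sum_congr rfl fun i hi => ?_
      have : i = h := by
        by_contra hne
        exact DFinsupp.mem_support_iff.mp hi (hH [] i (by simpa using hne))
      subst this
      rfl
    rw [Pi.smul_apply, base hH, base hF, smul_smul, neg_one_zpow_mul,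
      Finset.sum_comm, Finset.smul_sum, Finset.smul_sum]
    refine Finset.sum_congr rfl fun j hj => ?_
    rw [Finset.smul_sum, Finset.smul_sum]
    refine Finset.sum_congr rfl fun i hi => ?_
    have hi' : i = h := by
      by_contra hne
      exact DFinsupp.mem_support_iff.mp hi (hH [] i (by simpa using hne))
    have hj' : j = f := by
      by_contra hne
      exact DFinsupp.mem_support_iff.mp hj (hF [] j (by simpa using hne))
    rw [show G [⟨i, H [] i⟩, ⟨j, F [] j⟩] = _ from hG [] [] ⟨j, F [] j⟩ ⟨i, H [] i⟩, smul_smul,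
      neg_one_zpow_mul]
    simp only [hi', hj', List.nil_append]
    rw [mul_comm h f]
  | cons X l ih =>
    have hFH := ih hF (hH.contract X) hG hGm hFm (hHm.contract X)
    have hFX := ih (hF.contract X) hH hG hGm (hFm.contract X) hHm
    have hGX := ih hF hH (hG.contract X) (hGm.contract X) hFm hHm
    have hsign : ((-1 : 𝕜) ^ (X.1 * h)) * (-1 : 𝕜) ^ ((f + X.1) * h) = (-1 : 𝕜) ^ (f * h) := by
      rw [neg_one_zpow_mul]
      exact neg_one_zpow_congr (X.1 * h) (by ring)
    have hFX' := congrArg (((-1 : 𝕜) ^ (X.1 * h)) • ·) hFX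
    simp only [Pi.smul_apply, smul_smul, hsign] at hFX'
    change contract X _ l = contract X _ l
    simp only [contract_sub, contract_smul, contract_insert, insert_add_right, insert_smul_right,
      insert_add_left _ _ _ hGm, insert_smul_left _ _ _ hGm]
    simp only [Pi.sub_apply, Pi.add_apply, Pi.smul_apply] at hFH hFX' hGX ⊢
    rw [show f * (h + X.1) = f * h + X.1 * f by ring, ← neg_one_zpow_mul] at hFH
    rw [show X.1 * (h + f) = X.1 * h + X.1 * f by ring,
      show X.1 * (f + h) = X.1 * h + X.1 * f by ring, ← neg_one_zpow_mul,
      show h + f + X.1 = h + X.1 + f by ring, show f + h + X.1 = f + X.1 + h by ring]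
    rw [show f + (h + X.1) = f + h + X.1 by ring] at hFH
    rw [show h + (f + X.1) = h + X.1 + f by ring] at hFX'
    rw [show f + h + X.1 = f + X.1 + h by ring] at hFH
    generalize (-1 : 𝕜) ^ (X.1 * h) = a at *
    generalize (-1 : 𝕜) ^ (X.1 * f) = b at *
    generalize (-1 : 𝕜) ^ (f * h) = c at *
    linear_combination (norm := module) hFH + hFX' + (a * b) • hGX

end ListForm

namespace RawForm

open ListForm

theorem toList_multilinear {F : RawForm E} (hF : IsMultilin 𝕜 E F) : F.toList.Multilinear 𝕜 := by
  have key : ∀ {n : ℕ} (y : Fin n → Σ i, E i) (j : Fin n) (i : ℤ) (_ : (y j).1 = i) (a b : E i)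
      (c : 𝕜),
      F.toList (List.ofFn (Function.update y j ⟨i, a + b⟩)) =
        F.toList (List.ofFn (Function.update y j ⟨i, a⟩)) +
          F.toList (List.ofFn (Function.update y j ⟨i, b⟩)) ∧
      F.toList (List.ofFn (Function.update y j ⟨i, c • a⟩)) =
        c • F.toList (List.ofFn (Function.update y j ⟨i, a⟩)) := by
    intro n y j i hi a b c
    subst hi
    simp only [update_eq_mk, toList_ofFn]
    exact hF n (fun t => (y t).1) (fun t => (y t).2) j a b c
  intro l r i a b c
  rw [append_cons_eq_ofFn l r ⟨i, a + b⟩ ⟨i, 0⟩, append_cons_eq_ofFn l r ⟨i, a⟩ ⟨i, 0⟩,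
    append_cons_eq_ofFn l r ⟨i, b⟩ ⟨i, 0⟩, append_cons_eq_ofFn l r ⟨i, c • a⟩ ⟨i, 0⟩]
  exact key _ _ i (by simp) a b c

theorem toList_symmetric {F : RawForm E} (hF : IsGradedSym 𝕜 E F) : F.toList.Symmetric 𝕜 := by
  intro l r X Y
  set L := l ++ X :: Y :: r with hL
  have hp : l.length < L.length := by simp [hL]
  have hq : l.length + 1 < L.length := by simp [hL]
  have hswap : l ++ Y :: X :: r =
      List.ofFn fun j => L.get (Equiv.swap ⟨l.length, hp⟩ ⟨l.length + 1, hq⟩ j) := by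
    refine List.ext_getElem (by simp only [hL, List.length_append, List.length_cons, List.length_ofFn])
      fun i h₁ h₂ => ?_
    rw [List.getElem_ofFn]
    by_cases h : i = l.length
    · subst h
      simp [hL]
    by_cases h' : i = l.length + 1
    · subst h'
      simp [hL]
    rw [Equiv.swap_apply_of_ne_of_ne (by simpa [Fin.ext_iff] using h)
      (by simpa [Fin.ext_iff] using h')]
    simp only [hL, List.get_eq_getElem, List.getElem_append, List.getElem_cons]
    split_ifs <;> first | rfl | omega
  rw [hswap, toList_ofFn]
  have h := hF L.length (fun j => (L.get j).1) (fun j => (L.get j).2) ⟨l.length, hp⟩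
    ⟨l.length + 1, hq⟩ rfl
  simpa [hL, toList] using h

theorem toList_hasDegree {F : RawForm E} {d : ℤ} (hF : IsOfDeg E d F) : F.toList.HasDegree d := by
  intro l m hm
  refine hF _ _ _ m fun h => hm (h.trans ?_)
  congr 1
  rw [← List.sum_ofFn]
  congr 1
  exact List.ext_getElem (by simp) (by simp)

end RawForm

section Shuffles

/-- Extend a permutation of `Fin n` to `Fin (n + 1)` by sending `p` to `0`. -/
def extendPerm {n : ℕ} (p : Fin (n + 1)) (τ : Equiv.Perm (Fin n)) : Equiv.Perm (Fin (n + 1)) :=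
  (finSuccEquiv' p).trans ((Equiv.optionCongr τ).trans (finSuccEquiv' 0).symm)

theorem extendPerm_self {n : ℕ} (p : Fin (n + 1)) (τ : Equiv.Perm (Fin n)) :
    extendPerm p τ p = 0 := by
  simp [extendPerm]

theorem extendPerm_succAbove {n : ℕ} (p : Fin (n + 1)) (τ : Equiv.Perm (Fin n)) (i : Fin n) :
    extendPerm p τ (p.succAbove i) = (τ i).succ := by
  simp [extendPerm]

theorem extendPerm_bijective (n : ℕ) :
    Function.Bijective fun a : Fin (n + 1) × Equiv.Perm (Fin n) => extendPerm a.1 a.2 := by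
  constructor
  · rintro ⟨p, τ⟩ ⟨q, ρ⟩ h
    have h : extendPerm p τ = extendPerm q ρ := h
    have hpq : p = q := (extendPerm q ρ).injective <| by
      rw [← h, extendPerm_self, h, extendPerm_self]
    subst hpq
    refine Prod.ext rfl (Equiv.ext fun i => Fin.succ_injective _ ?_)
    rw [← extendPerm_succAbove p τ, h, extendPerm_succAbove]
  · intro σ
    set p := σ.symm 0 with hp
    have hne : ∀ i, σ (p.succAbove i) ≠ 0 := fun i h =>
      Fin.succAbove_ne p i ((Equiv.eq_symm_apply σ).mpr h)
    have hinj : Function.Injective fun i => (σ (p.succAbove i)).pred (hne i) := fun i j h =>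
      Fin.succAbove_right_injective (σ.injective (Fin.pred_inj.mp h))
    refine ⟨(p, Equiv.ofBijective _ (Finite.injective_iff_bijective.mp hinj)), ?_⟩
    refine Equiv.ext fun j => ?_
    rcases Fin.eq_self_or_eq_succAbove p j with rfl | ⟨i, rfl⟩
    · simp [extendPerm_self, hp]
    · simp [extendPerm_succAbove]

theorem val_succAbove {n : ℕ} (p : Fin (n + 1)) (i : Fin n) :
    ((p.succAbove i : Fin (n + 1)) : ℕ) = if (i : ℕ) < p then (i : ℕ) else i + 1 := by
  simp only [Fin.succAbove, Fin.lt_def, Fin.val_castSucc]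
  split_ifs <;> simp

theorem isShuffle_extendPerm {n k : ℕ} (p : Fin (n + 1)) (τ : Equiv.Perm (Fin n)) :
    IsShuffle k (extendPerm p τ) ↔
      ((p : ℕ) = 0 ∧ 1 ≤ k ∧ IsShuffle (k - 1) τ) ∨ ((p : ℕ) = k ∧ IsShuffle k τ) := by
  have hval := val_succAbove p
  constructor
  · intro h
    have hlt : ∀ i : Fin n, (i : ℕ) < p → k ≤ (p : ℕ) ∧ (i : ℕ) < k := by
      intro i hi
      by_contra hcon
      have hv : ((p.succAbove i : Fin (n + 1)) : ℕ) = i := by rw [hval, if_pos hi]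
      have := h (p.succAbove i) p (by rw [Fin.lt_def, hv]; exact hi) (by rw [hv]; omega)
      rw [extendPerm_self] at this
      exact absurd this (Fin.not_lt_zero _)
    have hτ : ∀ i j : Fin n, i < j →
        (((p.succAbove j : Fin (n + 1)) : ℕ) < k ∨ k ≤ ((p.succAbove i : Fin (n + 1)) : ℕ)) →
        τ i < τ j := by
      intro i j hij hk
      have := h _ _ (Fin.succAbove_lt_succAbove_iff.mpr hij) hk
      rw [extendPerm_succAbove, extendPerm_succAbove] at this
      exact Fin.succ_lt_succ_iff.mp this
    have hcase : ((p : ℕ) = 0 ∧ 1 ≤ k) ∨ (p : ℕ) = k := by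
      by_cases hp : (p : ℕ) = 0
      · omega
      · have hpn := p.isLt
        have := hlt ⟨(p : ℕ) - 1, by omega⟩ (by change (p : ℕ) - 1 < p; omega)
        simp only at this
        omega
    rcases hcase with ⟨hp, hk⟩ | hp
    · refine Or.inl ⟨hp, hk, fun i j hij hc => hτ i j hij ?_⟩
      rw [hval, hval, hp]
      simp only [Nat.not_lt_zero, if_false]
      omega
    · refine Or.inr ⟨hp, fun i j hij hc => hτ i j hij ?_⟩
      rw [hval, hval, hp]
      split_ifs <;> omega
  · intro h i j hij hc
    rcases Fin.eq_self_or_eq_succAbove p i with rfl | ⟨i, rfl⟩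
    · rcases Fin.eq_self_or_eq_succAbove i j with rfl | ⟨j, rfl⟩
      · exact absurd hij (lt_irrefl _)
      · rw [extendPerm_self, extendPerm_succAbove]
        exact Fin.succ_pos _
    · rcases Fin.eq_self_or_eq_succAbove p j with rfl | ⟨j, rfl⟩
      · exfalso
        rw [Fin.lt_def] at hij
        omega
      · rw [extendPerm_succAbove, extendPerm_succAbove, Fin.succ_lt_succ_iff]
        have hij' := Fin.succAbove_lt_succAbove_iff.mp hij
        rw [hval, hval] at hc
        rcases h with ⟨hp, hk, h⟩ | ⟨hp, h⟩
        · refine h i j hij' ?_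
          simp only [hp, Nat.not_lt_zero, if_false] at hc
          omega
        · refine h i j hij' ?_
          rw [hp] at hc
          split_ifs at hc <;> omega

/-- Sums over shuffles of `Fin (n + 1)` split according to the position of `0`. -/
theorem sum_shuffles_succ {M : Type*} [AddCommMonoid M] (n : ℕ)
    (f : ℕ → Equiv.Perm (Fin (n + 1)) → M) :
    ∑ k : Fin (n + 2), ∑ σ ∈ Finset.univ.filter
        (fun σ : Equiv.Perm (Fin (n + 1)) => IsShuffle (k : ℕ) σ), f k σ =
      ∑ k : Fin (n + 1), ∑ τ ∈ Finset.univ.filter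
        (fun τ : Equiv.Perm (Fin n) => IsShuffle (k : ℕ) τ),
          (f (k + 1) (extendPerm 0 τ) + f k (extendPerm k τ)) := by
  have hsplit : ∀ k : ℕ, ∑ σ ∈ Finset.univ.filter
        (fun σ : Equiv.Perm (Fin (n + 1)) => IsShuffle k σ), f k σ =
      (if 1 ≤ k then ∑ τ : Equiv.Perm (Fin n),
        if IsShuffle (k - 1) τ then f k (extendPerm 0 τ) else 0 else 0) +
      ∑ p : Fin (n + 1), if (p : ℕ) = k then ∑ τ : Equiv.Perm (Fin n),
        if IsShuffle k τ then f k (extendPerm p τ) else 0 else 0 := by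
    intro k
    rw [Finset.sum_filter, ← (extendPerm_bijective n).sum_comp, Fintype.sum_prod_type]
    have hterm : ∀ p : Fin (n + 1), ∑ τ : Equiv.Perm (Fin n),
        (if IsShuffle k (extendPerm p τ) then f k (extendPerm p τ) else 0) =
        (if p = 0 then if 1 ≤ k then ∑ τ : Equiv.Perm (Fin n),
          if IsShuffle (k - 1) τ then f k (extendPerm p τ) else 0 else 0 else 0) +
        if (p : ℕ) = k then ∑ τ : Equiv.Perm (Fin n),
          if IsShuffle k τ then f k (extendPerm p τ) else 0 else 0 := by
      intro p
      simp only [isShuffle_extendPerm]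
      by_cases hp : p = 0
      · subst hp
        by_cases hk : 1 ≤ k
        · have : (0 : ℕ) ≠ k := by omega
          simp [hk, this]
        · have : k = 0 := by omega
          subst this
          simp
      · have : (p : ℕ) ≠ 0 := fun h => hp (Fin.ext h)
        by_cases hpk : (p : ℕ) = k
        · have hk : k ≠ 0 := hpk ▸ this
          simp [hp, hpk, hk]
        · simp [hp, hpk]
    simp only [hterm, Finset.sum_add_distrib, Finset.sum_ite_eq', Finset.mem_univ, if_true]
  simp only [hsplit, Finset.sum_add_distrib]
  congr 1
  · rw [Fin.sum_univ_succ]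
    simp [Finset.sum_filter]
  · rw [Fin.sum_univ_castSucc]
    have hlast : ∀ p : Fin (n + 1), (p : ℕ) ≠ n + 1 := fun p => p.isLt.ne
    simp [hlast, Finset.sum_filter, ← Fin.ext_iff]

theorem koszulSign_eq_prod {n : ℕ} (ι : Fin n → ℤ) (σ : Equiv.Perm (Fin n)) :
    koszulSign 𝕜 ι σ = ∏ i, ∏ j, if i < j ∧ σ j < σ i then (-1 : 𝕜) ^ (ι (σ i) * ι (σ j)) else 1 := by
  rw [koszulSign, Finset.prod_filter, Fintype.prod_prod_type]

theorem koszulSign_extendPerm {n : ℕ} (ι : Fin (n + 1) → ℤ) (p : Fin (n + 1))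
    (τ : Equiv.Perm (Fin n)) :
    koszulSign 𝕜 ι (extendPerm p τ) =
      (-1 : 𝕜) ^ (ι 0 * ∑ i : Fin n, if (i : ℕ) < p then ι (τ i).succ else 0) *
        koszulSign 𝕜 (fun i => ι i.succ) τ := by
  have hzpow : ∀ g : Fin n → ℤ, (-1 : 𝕜) ^ (∑ i, g i) = ∏ i, (-1 : 𝕜) ^ g i := by
    intro g
    induction (Finset.univ : Finset (Fin n)) using Finset.induction_on with
    | empty => simp
    | insert a s ha ih => rw [Finset.sum_insert ha, Finset.prod_insert ha, zpow_add₀ (by simp), ih]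
  rw [koszulSign_eq_prod, koszulSign_eq_prod, Fin.prod_univ_succAbove _ p, Finset.mul_sum, hzpow]
  simp only [Fin.prod_univ_succAbove _ p, extendPerm_self, extendPerm_succAbove,
    Fin.succAbove_lt_succAbove_iff, Fin.succ_lt_succ_iff, Finset.prod_mul_distrib]
  simp only [Fin.not_lt_zero, Fin.succ_pos, Fin.succAbove_lt_iff_castSucc_lt, and_false, and_true,
    if_false, Finset.prod_const_one, one_mul, mul_one]
  refine congrArg (· * _) (Finset.prod_congr rfl fun i _ => ?_)
  rw [mul_comm (ι 0)]
  by_cases h : (i : ℕ) < p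
  · rw [if_pos (show i.castSucc < p from h), if_pos h]
  · rw [if_neg (show ¬ i.castSucc < p from h), if_neg h, zero_mul, zpow_zero]

theorem ofFn_comp_extendPerm {α : Type*} {n : ℕ} (y : Fin (n + 1) → α) (p : Fin (n + 1))
    (τ : Equiv.Perm (Fin n)) :
    (List.ofFn fun i => y (extendPerm p τ i)) =
      (List.ofFn fun i => y (τ i).succ).take p ++
        y 0 :: (List.ofFn fun i => y (τ i).succ).drop p := by
  have hpn := p.isLt
  refine List.ext_getElem (by simp; omega) fun i h₁ h₂ => ?_
  rw [List.length_ofFn] at h₁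
  rw [List.getElem_ofFn]
  have hmin : min (p : ℕ) n = p := by omega
  rcases Fin.eq_self_or_eq_succAbove p ⟨i, h₁⟩ with h | ⟨j, h⟩
  · have hi : i = p := congrArg Fin.val h
    rw [h, extendPerm_self]
    subst hi
    simp [hmin]
  · rw [h, extendPerm_succAbove]
    have hi : i = (p.succAbove j : Fin (n + 1)) := congrArg Fin.val h
    rw [val_succAbove] at hi
    split_ifs at hi with hj
    · subst hi
      simp [hmin, hj]
    · subst hi
      have h1 : ¬ (j : ℕ) + 1 < p := by omega
      have h2 : (j : ℕ) + 1 - p = (j - p) + 1 := by omega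
      have h3 : (p : ℕ) + (j - p) = j := by omega
      simp [List.getElem_append, hmin, h1, h2, h3]

namespace ListForm

theorem Symmetric.plug_cons {G : ListForm E} (hG : G.Symmetric 𝕜) {w : ⨁ i, E i} {d : ℤ}
    (hw : ∀ m, m ≠ d → w m = 0) (X : Σ i, E i) (r : List (Σ i, E i)) :
    G.plug w (X :: r) = ((-1 : 𝕜) ^ (X.1 * d)) • (G.contract X).plug w r := by
  simp only [plug, DFinsupp.sum, Finset.smul_sum]
  refine Finset.sum_congr rfl fun m hm => ?_
  have hmd : m = d := by
    by_contra hne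
    exact DFinsupp.mem_support_iff.mp hm (hw m hne)
  subst hmd
  exact hG [] r X ⟨m, w m⟩

/-- The insertion as a sum over shuffles of a tuple. -/
def shuffleSum (𝕜 : Type) [Field 𝕜] [∀ i, Module 𝕜 (E i)] (F G : ListForm E) {n : ℕ}
    (y : Fin n → Σ i, E i) : ⨁ i, E i :=
  ∑ k : Fin (n + 1), ∑ σ ∈ Finset.univ.filter
    (fun σ : Equiv.Perm (Fin n) => IsShuffle (k : ℕ) σ),
      koszulSign 𝕜 (fun j => (y j).1) σ •
        G.plug (F ((List.ofFn fun i => y (σ i)).take k)) ((List.ofFn fun i => y (σ i)).drop k)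

theorem shuffleSum_succ {f : ℤ} {F G : ListForm E} (hF : F.HasDegree f) (hG : G.Symmetric 𝕜)
    {n : ℕ} (y : Fin (n + 1) → Σ i, E i) :
    shuffleSum 𝕜 F G y = shuffleSum 𝕜 (F.contract (y 0)) G (fun i => y i.succ) +
      ((-1 : 𝕜) ^ ((y 0).1 * f)) • shuffleSum 𝕜 F (G.contract (y 0)) fun i => y i.succ := by
  have h := sum_shuffles_succ n fun k σ => koszulSign 𝕜 (fun j => (y j).1) σ •
    G.plug (F ((List.ofFn fun i => y (σ i)).take k)) ((List.ofFn fun i => y (σ i)).drop k)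
  refine h.trans ?_
  simp only [shuffleSum, Finset.smul_sum, ← Finset.sum_add_distrib]
  refine Finset.sum_congr rfl fun k _ => Finset.sum_congr rfl fun τ _ => ?_
  set L := List.ofFn fun i => y (τ i).succ with hL
  have hk : (L.take k).length = k := by
    rw [List.length_take, hL, List.length_ofFn]
    exact min_eq_left (Nat.lt_succ_iff.mp k.isLt)
  have htake : ∀ l : List (Σ i, E i), (L.take k ++ l).take k = L.take k := fun l =>
    List.take_left' hk
  have hdrop : ∀ l : List (Σ i, E i), (L.take k ++ l).drop k = l := fun l => List.drop_left' hk
  have hsum : ((L.take k).map Sigma.fst).sum =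
      ∑ i : Fin n, if (i : ℕ) < k then (y (τ i).succ).1 else 0 := by
    rw [List.map_take, hL, List.map_ofFn, List.sum_take_ofFn, Finset.sum_filter]
    rfl
  rw [ofFn_comp_extendPerm, ofFn_comp_extendPerm, koszulSign_extendPerm, koszulSign_extendPerm,
    ← hL, htake, hdrop, hG.plug_cons (hF (L.take k)), hsum, smul_smul, smul_smul]
  congr 1
  · simp [contract]
  · congr 1
    rw [mul_right_comm, neg_one_zpow_mul]
    congr 1
    set s := ∑ i : Fin n, if (i : ℕ) < k then (y (τ i).succ).1 else 0
    exact neg_one_zpow_congr ((y 0).1 * s) (by ring)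

theorem shuffleSum_eq_insert {f : ℤ} {F G : ListForm E} (hF : F.HasDegree f)
    (hG : G.Symmetric 𝕜) {n : ℕ} (y : Fin n → Σ i, E i) :
    shuffleSum 𝕜 F G y = insert 𝕜 f F G (List.ofFn y) := by
  induction n generalizing f F G with
  | zero =>
    have hshuffle : ∀ σ : Equiv.Perm (Fin 0), IsShuffle 0 σ := fun _ i => i.elim0
    simp [shuffleSum, insert, hshuffle, koszulSign]
  | succ n ih =>
    rw [shuffleSum_succ hF hG, ih (hF.contract _) hG, ih hF (hG.contract _), List.ofFn_succ]
    rfl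

end ListForm

theorem RawForm.ins_eq_shuffleSum (F G : RawForm E) {n : ℕ} (ι : Fin n → ℤ) (x : ∀ j, E (ι j)) :
    ins 𝕜 E F G n ι x = ListForm.shuffleSum 𝕜 F.toList G.toList
      (fun j => (⟨ι j, x j⟩ : Σ i, E i)) := by
  refine Finset.sum_congr rfl fun k _ => Finset.sum_congr rfl fun σ _ => ?_
  have hk := k.isLt
  have htake : (List.ofFn fun i => (⟨ι (σ i), x (σ i)⟩ : Σ i, E i)).take k =
      List.ofFn fun i : Fin k => (⟨ι (σ ⟨i, by omega⟩), x (σ ⟨i, by omega⟩)⟩ : Σ i, E i) :=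
    List.ext_getElem (by simp; omega) fun i h₁ h₂ => by simp
  have hdrop : (List.ofFn fun i => (⟨ι (σ i), x (σ i)⟩ : Σ i, E i)).drop k =
      List.ofFn fun i : Fin (n - k) =>
        (⟨ι (σ ⟨k + i, by omega⟩), x (σ ⟨k + i, by omega⟩)⟩ : Σ i, E i) :=
    List.ext_getElem (by simp) fun i h₁ h₂ => by simp
  rw [htake, hdrop, toList_ofFn]
  simp only [ListForm.plug, toList_cons]

theorem RawForm.toList_ins {f : ℤ} {F G : RawForm E} (hF : F.toList.HasDegree f)
    (hG : G.toList.Symmetric 𝕜) :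
    (ins 𝕜 E F G).toList = ListForm.insert 𝕜 f F.toList G.toList := by
  funext l
  have h := List.ofFn_get l
  rw [← h, toList_ofFn, ins_eq_shuffleSum, ListForm.shuffleSum_eq_insert hF hG]

theorem RawForm.toList_rnb {f g : ℤ} {F G : RawForm E} (hF : F.toList.HasDegree f)
    (hG : G.toList.HasDegree g) (hFs : F.toList.Symmetric 𝕜) (hGs : G.toList.Symmetric 𝕜) :
    (rnb 𝕜 E f g F G).toList = ListForm.insert 𝕜 f F.toList G.toList -
      ((-1 : 𝕜) ^ (f * g)) • ListForm.insert 𝕜 g G.toList F.toList := by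
  rw [← toList_ins hF hGs, ← toList_ins hG hFs]
  rfl

end Shuffles

namespace ListForm

theorem Symmetric.sub_smul {F G : ListForm E} (hF : F.Symmetric 𝕜) (hG : G.Symmetric 𝕜) (c : 𝕜) :
    (F - c • G).Symmetric 𝕜 := fun l r X Y => by
  simp only [Pi.sub_apply, Pi.smul_apply, hF l r X Y, hG l r X Y, smul_sub, smul_comm c]

theorem HasDegree.sub_smul {F G : ListForm E} {d : ℤ} (hF : F.HasDegree d) (hG : G.HasDegree d)
    (c : 𝕜) : (F - c • G).HasDegree d := fun l m hm => by
  simp only [Pi.sub_apply, Pi.smul_apply]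
  rw [DirectSum.sub_apply, DirectSum.smul_apply, hF l m hm, hG l m hm, smul_zero, sub_zero]

end ListForm

/-- If `μ` squares to zero, then so does the bracket with `μ` on degree zero forms. -/
theorem rnb_rnb_self_eq_zero [CharZero 𝕜] {μ K : RawForm E} (hμ : IsSVF 𝕜 E 1 μ)
    (hμμ : rnb 𝕜 E 1 1 μ μ = 0) (hK : IsSVF 𝕜 E 0 K) :
    rnb 𝕜 E 1 1 μ (rnb 𝕜 E 0 1 K μ) = 0 := by
  have hMm := RawForm.toList_multilinear hμ.1
  have hMs := RawForm.toList_symmetric hμ.2.1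
  have hMd := RawForm.toList_hasDegree hμ.2.2
  have hKm := RawForm.toList_multilinear hK.1
  have hKs := RawForm.toList_symmetric hK.2.1
  have hKd := RawForm.toList_hasDegree hK.2.2
  have hB := RawForm.toList_rnb hKd hMd hKs hMs
  have hBs : (rnb 𝕜 E 0 1 K μ).toList.Symmetric 𝕜 := hB ▸
    (ListForm.insert_symmetric hKs hMs hMm).sub_smul (ListForm.insert_symmetric hMs hKs hKm) _
  have hBd : (rnb 𝕜 E 0 1 K μ).toList.HasDegree 1 := hB ▸
    ListForm.HasDegree.sub_smul (d := 1) (ListForm.insert_hasDegree hKd hMd)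
      (ListForm.insert_hasDegree hMd hKd) _
  have hMM := RawForm.toList_rnb hMd hMd hMs hMs
  refine RawForm.toList_injective ((RawForm.toList_rnb hMd hBd hMs hBs).trans ?_)
  change _ = (0 : ListForm E)
  rw [hμμ, show RawForm.toList (0 : RawForm E) = 0 from rfl] at hMM
  rw [hB]
  generalize μ.toList = M at *
  generalize K.toList = L at *
  have hsq : ListForm.insert 𝕜 1 M M = 0 := by
    have h2 : (2 : 𝕜) • ListForm.insert 𝕜 1 M M = 0 := by
      rw [two_smul]
      simpa using hMM.symm
    exact (smul_eq_zero.mp h2).resolve_left two_ne_zero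
  have hM := ListForm.insert_associator hKd hMd hMs hMm hKm hMm
  have hL := ListForm.insert_associator hMd hMd hKs hKm hMm hMm
  rw [hsq, ListForm.insert_zero_right, zero_sub] at hM
  rw [hsq, ListForm.insert_zero_left _ hKm, sub_zero] at hL
  have hL0 : ListForm.insert 𝕜 1 M (ListForm.insert 𝕜 1 M L) = 0 := by
    have h2 : (2 : 𝕜) • ListForm.insert 𝕜 1 M (ListForm.insert 𝕜 1 M L) = 0 := by
      rw [two_smul]
      nth_rewrite 1 [hL]
      simp
    exact (smul_eq_zero.mp h2).resolve_left two_ne_zero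
  simp only [zpow_zero, one_smul, mul_one, zpow_one, neg_smul, sub_neg_eq_add,
    ListForm.insert_sub_right, ListForm.insert_sub_left _ _ _ hMm, hL0, sub_zero, zero_add,
    add_zero] at hM ⊢
  rw [← add_sub_assoc, add_sub_right_comm, hM, neg_add_cancel]

end ListForms

/-- Let `μ` be a symmetric vector valued form of degree 1 with
`[μ,μ]_RN = 0` (e.g. a (curved) `L∞`-structure) and `𝒩` a symmetric vector valued form of
degree 0.  If `𝒩` is Nijenhuis with respect to `μ` (with a square `𝒦`), then `𝒩` is weak
Nijenhuis with respect to `μ`, i.e. `[μ,[𝒩,[𝒩,μ]_RN]_RN]_RN = 0`. -/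
theorem statement5 (𝕜 : Type) [Field 𝕜] [CharZero 𝕜]
    (E : ℤ → Type) [∀ i, AddCommGroup (E i)] [∀ i, Module 𝕜 (E i)]
    (μ N K : RawForm E)
    (hμ : IsSVF 𝕜 E 1 μ) (hμμ : rnb 𝕜 E 1 1 μ μ = 0)
    (hN : IsSVF 𝕜 E 0 N) (hK : IsSVF 𝕜 E 0 K)
    (hsq : rnb 𝕜 E 0 1 N (rnb 𝕜 E 0 1 N μ) = rnb 𝕜 E 0 1 K μ)
    (hcom : rnb 𝕜 E 0 0 N K = 0) :
    rnb 𝕜 E 1 1 μ (rnb 𝕜 E 0 1 N (rnb 𝕜 E 0 1 N μ)) = 0 := by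
  rw [hsq]
  exact rnb_rnb_self_eq_zero hμ hμμ hK

end RN
end
end
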